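/- Let (M, g, F) be a solution of the Einstein/Maxwell equations with Killing field ξ leaving F invariant, and suppose M is simply connected. Define α = i_ξ F, β = i_ξ(∗F), and the twist ω = ∗(dξ ∧ ξ). Then dα = 0, dβ = 0, and dω = 4 α ∧ β; in particular there exist potentials χ, ψ with dχ = α, dψ = β, and the 1-form ω − 2(χ dψ − ψ dχ) is closed, hence exact. -/

import Mathlib

/-!
STATEMENT 11: for a simply connected solution `(M, g, F)` of the
Einstein/Maxwell equations with a Killing field `ξ` leaving `F` invariant, the
1-forms `α = i_ξ F` and `β = i_ξ ∗F` are closed, the twist `ω = ∗(dξ ∧ ξ)`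
satisfies `dω = 4 α ∧ β`, there exist potentials `χ, ψ` with `dχ = α`,
`dψ = β`, and the 1-form `ω − 2(χ dψ − ψ dχ)` is closed, hence exact.

Everything is written in coordinates on a simply connected open set
`Ω ⊆ ℝ⁴`: the metric `g`, field `F` and Killing vector `ξ` are given by their
components, the Ricci tensor is computed from the Christoffel symbols of `g`,
and `∗` is the Hodge star of `g` (with volume density `√|det g|`).
-/

open MeasureTheory Matrix

noncomputable section

abbrev E4 := EuclideanSpace ℝ (Fin 4)

/-- Partial derivative `∂_i f(x)`. -/
noncomputable def pd (i : Fin 4) (f : E4 → ℝ) (x : E4) : ℝ :=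
  fderiv ℝ f x (EuclideanSpace.single i (1 : ℝ))

/-- The inverse metric `g^{μν}`. -/
noncomputable def ginv (g : E4 → Matrix (Fin 4) (Fin 4) ℝ) (x : E4) :
    Matrix (Fin 4) (Fin 4) ℝ := (g x)⁻¹

/-- The metric volume density `√|det g|`. -/
noncomputable def vol (g : E4 → Matrix (Fin 4) (Fin 4) ℝ) (x : E4) : ℝ :=
  Real.sqrt |(g x).det|

/-- The Levi-Civita permutation symbol `ε_{abcd}` (`= det of the matrix of the
corresponding standard basis vectors`). -/
noncomputable def epsSymb (a b c d : Fin 4) : ℝ :=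
  Matrix.det (Matrix.of fun i j => if (![a, b, c, d] i) = j then (1 : ℝ) else 0)

/-- Christoffel symbols `Γ^s_{μν}` of the metric `g`. -/
noncomputable def Christoffel (g : E4 → Matrix (Fin 4) (Fin 4) ℝ)
    (x : E4) (s μ ν : Fin 4) : ℝ :=
  (1 / 2) * ∑ l, ginv g x s l *
    (pd μ (fun y => g y ν l) x + pd ν (fun y => g y μ l) x - pd l (fun y => g y μ ν) x)

/-- The Ricci tensor `R_{μν}` of the metric `g`. -/
noncomputable def RicciT (g : E4 → Matrix (Fin 4) (Fin 4) ℝ)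
    (x : E4) (μ ν : Fin 4) : ℝ :=
  (∑ s, (pd s (fun y => Christoffel g y s μ ν) x - pd μ (fun y => Christoffel g y s s ν) x)) +
    ∑ s, ∑ l, (Christoffel g x s s l * Christoffel g x l μ ν -
      Christoffel g x s μ l * Christoffel g x l s ν)

/-- `‖F‖² = (1/2) F^{ab} F_{ab}`. -/
noncomputable def normF2 (g F : E4 → Matrix (Fin 4) (Fin 4) ℝ) (x : E4) : ℝ :=
  (1 / 2) * ∑ a, ∑ b, ∑ c, ∑ d, ginv g x a c * ginv g x b d * F x a b * F x c d

/-- The electromagnetic energy-momentum tensor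
`T_F(∂_μ,∂_ν) = i_{∂_μ}F · i_{∂_ν}F − (1/2)‖F‖² g_{μν}`. -/
noncomputable def TF (g F : E4 → Matrix (Fin 4) (Fin 4) ℝ) (x : E4) (μ ν : Fin 4) : ℝ :=
  (∑ a, ∑ b, ginv g x a b * F x μ a * F x ν b) - (1 / 2) * normF2 g F x * g x μ ν

/-- The Hodge dual `(∗F)_{μν} = (1/2) F^{ab} ε_{abμν}` of a 2-form, with
`ε = √|det g| ·` (permutation symbol). -/
noncomputable def star2 (g F : E4 → Matrix (Fin 4) (Fin 4) ℝ) (x : E4) (μ ν : Fin 4) : ℝ :=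
  (vol g x / 2) * ∑ a, ∑ b,
    (∑ c, ∑ d, ginv g x a c * ginv g x b d * F x c d) * epsSymb a b μ ν

/-- The Hodge dual `(∗W)_μ = (1/3!) W^{abc} ε_{abcμ}` of a 3-form `W`. -/
noncomputable def star3 (g : E4 → Matrix (Fin 4) (Fin 4) ℝ)
    (W : E4 → Fin 4 → Fin 4 → Fin 4 → ℝ) (x : E4) (μ : Fin 4) : ℝ :=
  (vol g x / 6) * ∑ a, ∑ b, ∑ c,
    (∑ p, ∑ q, ∑ r, ginv g x a p * ginv g x b q * ginv g x c r * W x p q r) *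
      epsSymb a b c μ

/-- The metric-dual 1-form `ξ_μ = g_{μν} ξ^ν` of the vector field `ξ`. -/
noncomputable def formOf (g : E4 → Matrix (Fin 4) (Fin 4) ℝ) (ξ : E4 → Fin 4 → ℝ)
    (x : E4) (μ : Fin 4) : ℝ := ∑ ν, g x μ ν * ξ x ν

/-- `(dξ)_{μν}` for the 1-form `ξ^♭`. -/
noncomputable def dform (g : E4 → Matrix (Fin 4) (Fin 4) ℝ) (ξ : E4 → Fin 4 → ℝ)
    (x : E4) (μ ν : Fin 4) : ℝ :=
  pd μ (fun y => formOf g ξ y ν) x - pd ν (fun y => formOf g ξ y μ) x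

/-- The Lie derivative `(L_ξ T)_{μν}` of a covariant 2-tensor `T`. -/
noncomputable def lieD (ξ : E4 → Fin 4 → ℝ) (T : E4 → Matrix (Fin 4) (Fin 4) ℝ)
    (x : E4) (μ ν : Fin 4) : ℝ :=
  ∑ s, (ξ x s * pd s (fun y => T y μ ν) x + T x s ν * pd μ (fun y => ξ y s) x +
    T x μ s * pd ν (fun y => ξ y s) x)

/-- `α = i_ξ F`, in components `α_μ = ξ^ν F_{νμ}`. -/
noncomputable def alphaF (F : E4 → Matrix (Fin 4) (Fin 4) ℝ) (ξ : E4 → Fin 4 → ℝ)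
    (x : E4) (μ : Fin 4) : ℝ := ∑ ν, ξ x ν * F x ν μ

/-- `β = i_ξ ∗F`. -/
noncomputable def betaF (g F : E4 → Matrix (Fin 4) (Fin 4) ℝ) (ξ : E4 → Fin 4 → ℝ)
    (x : E4) (μ : Fin 4) : ℝ := ∑ ν, ξ x ν * star2 g F x ν μ

/-- The 3-form `dξ ∧ ξ`. -/
noncomputable def dxiWedgeXi (g : E4 → Matrix (Fin 4) (Fin 4) ℝ) (ξ : E4 → Fin 4 → ℝ)
    (x : E4) (a b c : Fin 4) : ℝ :=
  dform g ξ x a b * formOf g ξ x c + dform g ξ x b c * formOf g ξ x a +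
    dform g ξ x c a * formOf g ξ x b

/-- The twist 1-form `ω = ∗(dξ ∧ ξ)`. -/
noncomputable def twistF (g : E4 → Matrix (Fin 4) (Fin 4) ℝ) (ξ : E4 → Fin 4 → ℝ)
    (x : E4) (μ : Fin 4) : ℝ := star3 g (dxiWedgeXi g ξ) x μ

section Poincare

open Set Filter Topology

/-- The real numbers with the discrete topology. -/
@[ext]
structure DiscreteReal where
  /-- The underlying real number. -/
  toReal : ℝ

instance : TopologicalSpace DiscreteReal := ⊥

instance : DiscreteTopology DiscreteReal := ⟨rfl⟩

/-- The bundle over `Ω` of germs of a function whose local representatives `f i` on the balls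
`Metric.ball i (r i)` differ from each other by locally constant functions. -/
noncomputable def germBundle {E : Type*} [NormedAddCommGroup E] (Ω : Set E)
    (r : Ω → ℝ) (hr : ∀ i, 0 < r i) (f : Ω → E → ℝ)
    (hf : ∀ i j : Ω, ∀ x ∈ Metric.ball (i : E) (r i) ∩ Metric.ball (j : E) (r j),
      ∀ᶠ y in 𝓝 x, f i y - f j y = f i x - f j x) :
    FiberBundleCore Ω Ω DiscreteReal where
  baseSet i := Subtype.val ⁻¹' Metric.ball (i : E) (r i)
  isOpen_baseSet i := Metric.isOpen_ball.preimage continuous_subtype_val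
  indexAt x := x
  mem_baseSet_at x := Metric.mem_ball_self (hr x)
  coordChange i j x c := ⟨c.toReal + (f i x - f j x)⟩
  coordChange_self i x _ v := by simp
  continuousOn_coordChange i j := by
    rintro ⟨x, c⟩ ⟨hx, -⟩
    refine ContinuousAt.continuousWithinAt ?_
    refine (continuousAt_const (y := (⟨c.toReal + (f i x - f j x)⟩ : DiscreteReal))).congr ?_
    have h1 : ∀ᶠ p : Ω × DiscreteReal in 𝓝 (x, c), p.2 = c :=
      continuousAt_snd.eventually (p := fun d : DiscreteReal => d = c)
        ((isOpen_discrete {c}).mem_nhds rfl)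
    have h2 : ∀ᶠ p : Ω × DiscreteReal in 𝓝 (x, c), f i p.1 - f j p.1 = f i x - f j x :=
      have hc : ContinuousAt (fun p : Ω × DiscreteReal => (p.1 : E)) (x, c) := by fun_prop
      hc.eventually (hf i j x hx)
    filter_upwards [h1, h2] with p hp1 hp2
    rw [hp1, hp2]
  coordChange_comp i j k x _ v := by
    ext
    change v.toReal + (f i x - f j x) + (f j x - f k x) = v.toReal + (f i x - f k x)
    ring

/-- **Poincaré lemma for 1-forms** on simply connected open sets. -/
theorem IsOpen.exists_hasFDerivAt_of_fderiv_symmetric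
    {E : Type*} [NormedAddCommGroup E] [NormedSpace ℝ E]
    {Ω : Set E} (hΩ : IsOpen Ω) [SimplyConnectedSpace Ω] {ω : E → E →L[ℝ] ℝ}
    (hω : DifferentiableOn ℝ ω Ω)
    (hdω : ∀ a ∈ Ω, ∀ x y, fderiv ℝ ω a x y = fderiv ℝ ω a y x) :
    ∃ f : E → ℝ, ∀ a ∈ Ω, HasFDerivAt f (ω a) a := by
  classical
  have hball : ∀ i : Ω, ∃ r > 0, Metric.ball (i : E) r ⊆ Ω := fun i =>
    Metric.isOpen_iff.1 hΩ i i.2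
  choose r hr hrΩ using hball
  have hloc : ∀ i : Ω, ∃ f : E → ℝ, ∀ a ∈ Metric.ball (i : E) (r i), HasFDerivAt f (ω a) a :=
    fun i => (convex_ball _ _).exists_forall_hasFDerivAt_of_fderiv_symmetric Metric.isOpen_ball
      (hω.mono (hrΩ i)) fun a ha => hdω a (hrΩ i ha)
  choose f hf using hloc
  have hff : ∀ i j : Ω, ∀ x ∈ Metric.ball (i : E) (r i) ∩ Metric.ball (j : E) (r j),
      ∀ᶠ y in 𝓝 x, f i y - f j y = f i x - f j x := by
    intro i j x hx
    have hopen : IsOpen (Metric.ball (i : E) (r i) ∩ Metric.ball (j : E) (r j)) :=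
      Metric.isOpen_ball.inter Metric.isOpen_ball
    have hd : ∀ y ∈ Metric.ball (i : E) (r i) ∩ Metric.ball (j : E) (r j),
        HasFDerivAt (fun y => f i y - f j y) (0 : E →L[ℝ] ℝ) y := fun y hy =>
      ((hf i y hy.1).fun_sub (hf j y hy.2)).congr_fderiv (sub_self _)
    filter_upwards [hopen.mem_nhds hx] with y hy
    exact hopen.is_const_of_fderiv_eq_zero
      ((convex_ball _ _).inter (convex_ball _ _)).isPreconnected
      (fun z hz => (hd z hz).differentiableAt.differentiableWithinAt)
      (fun z hz => (hd z hz).fderiv) hy hx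
  let Z := germBundle Ω r hr f hff
  have hcov : IsCoveringMap Z.proj :=
    IsFiberBundle.isCoveringMap fun x => ⟨Z.localTriv x, Z.mem_baseSet_at x⟩
  have : LocallyPathConnectedSpace Ω := hΩ.locallyPathConnectedSpace
  obtain ⟨a₀⟩ : Nonempty Ω := PathConnectedSpace.nonempty
  obtain ⟨s, ⟨-, hs⟩, -⟩ := hcov.existsUnique_continuousMap_lifts (ContinuousMap.id Ω) a₀
    ⟨a₀, (⟨0⟩ : DiscreteReal)⟩ rfl
  have hs1 : ∀ x : Ω, (s x).1 = x := fun x => congrFun hs x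
  let c : Ω → ℝ := fun x => DiscreteReal.toReal (s x).2
  refine ⟨fun x => if hx : x ∈ Ω then f ⟨x, hx⟩ x + c ⟨x, hx⟩ else 0, fun a ha => ?_⟩
  let i : Ω := ⟨a, ha⟩
  have hai : a ∈ Metric.ball (i : E) (r i) := Metric.mem_ball_self (hr i)
  have hcont : ContinuousAt (fun x : Ω => (Z.localTriv i (s x)).2) i := by
    refine continuousAt_snd.comp
      (ContinuousAt.comp (g := Z.localTriv i) ?_ s.continuous.continuousAt)
    refine (Z.localTriv i).continuousAt ?_
    rw [Z.mem_localTriv_source, hs1]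
    exact Z.mem_baseSet_at i
  have hval : ∀ x : Ω, (Z.localTriv i (s x)).2 = ⟨c x + (f x x - f i x)⟩ := by
    intro x
    change (⟨c x + (f (s x).1 (s x).1 - f i (s x).1)⟩ : DiscreteReal) = _
    rw [hs1]
  have hev : ∀ᶠ x : Ω in 𝓝 i, c x + (f x x - f i x) = c i := by
    have h := hcont.eventually (p := fun d => d = (Z.localTriv i (s i)).2)
      ((isOpen_discrete {(Z.localTriv i (s i)).2}).mem_nhds rfl)
    filter_upwards [h] with x hx
    rw [hval, hval, sub_self, add_zero] at hx
    exact congrArg DiscreteReal.toReal hx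
  have hev' : ∀ᶠ x in 𝓝 a, (if hx : x ∈ Ω then f ⟨x, hx⟩ x + c ⟨x, hx⟩ else 0) = f i x + c i := by
    rw [nhds_subtype_eq_comap, eventually_comap] at hev
    filter_upwards [hev, hΩ.mem_nhds ha] with x hx hxΩ
    have := hx ⟨x, hxΩ⟩ rfl
    rw [dif_pos hxΩ]
    simp only at this
    linarith
  exact ((hf i a hai).add_const (c i)).congr_of_eventuallyEq hev'

end Poincare

section PartialDerivatives

open Topology

variable {Ω : Set E4} {f h : E4 → ℝ} {x : E4}

lemma ContDiffOn.differentiableAt_of_isOpen (hf : ContDiffOn ℝ (⊤ : ℕ∞) f Ω) (hΩ : IsOpen Ω)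
    (hx : x ∈ Ω) : DifferentiableAt ℝ f x :=
  (hf.contDiffAt (hΩ.mem_nhds hx)).differentiableAt (by simp)

lemma ContDiffOn.pd (hf : ContDiffOn ℝ (⊤ : ℕ∞) f Ω) (hΩ : IsOpen Ω) (i : Fin 4) :
    ContDiffOn ℝ (⊤ : ℕ∞) (pd i f) Ω :=
  (hf.fderiv_of_isOpen hΩ (m := (⊤ : ℕ∞)) (by norm_cast)).clm_apply contDiffOn_const

lemma pd_congr (hΩ : IsOpen Ω) (hx : x ∈ Ω) (hfh : ∀ y ∈ Ω, f y = h y) (i : Fin 4) :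
    pd i f x = pd i h x := by
  have : f =ᶠ[𝓝 x] h := by
    filter_upwards [hΩ.mem_nhds hx] with y hy using hfh y hy
  rw [pd, pd, this.fderiv_eq]

lemma pd_const (c : ℝ) (i : Fin 4) (x : E4) : pd i (fun _ => c) x = 0 := by
  simp [pd]

lemma pd_add (hf : DifferentiableAt ℝ f x) (hh : DifferentiableAt ℝ h x) (i : Fin 4) :
    pd i (fun y => f y + h y) x = pd i f x + pd i h x := by
  simp [pd, fderiv_fun_add hf hh]

lemma pd_sub (hf : DifferentiableAt ℝ f x) (hh : DifferentiableAt ℝ h x) (i : Fin 4) :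
    pd i (fun y => f y - h y) x = pd i f x - pd i h x := by
  simp [pd, fderiv_fun_sub hf hh]

lemma pd_neg (i : Fin 4) : pd i (fun y => -f y) x = -pd i f x := by
  simp [pd, fderiv_fun_neg]

lemma pd_mul (hf : DifferentiableAt ℝ f x) (hh : DifferentiableAt ℝ h x) (i : Fin 4) :
    pd i (fun y => f y * h y) x = f x * pd i h x + h x * pd i f x := by
  simp [pd, fderiv_fun_mul hf hh]

lemma pd_const_mul (hf : DifferentiableAt ℝ f x) (c : ℝ) (i : Fin 4) :
    pd i (fun y => c * f y) x = c * pd i f x := by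
  rw [pd_mul (differentiableAt_const c) hf, pd_const, mul_zero, add_zero]

lemma pd_mul_const (hf : DifferentiableAt ℝ f x) (c : ℝ) (i : Fin 4) :
    pd i (fun y => f y * c) x = pd i f x * c := by
  rw [pd_mul hf (differentiableAt_const c), pd_const, mul_zero, zero_add, mul_comm]

lemma pd_sum {ι : Type*} {s : Finset ι} {u : ι → E4 → ℝ}
    (hu : ∀ j ∈ s, DifferentiableAt ℝ (u j) x) (i : Fin 4) :
    pd i (fun y => ∑ j ∈ s, u j y) x = ∑ j ∈ s, pd i (u j) x := by
  simp [pd, fderiv_fun_sum hu]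

lemma pd_comm (hf : ContDiffOn ℝ (⊤ : ℕ∞) f Ω) (hΩ : IsOpen Ω) (hx : x ∈ Ω) (i j : Fin 4) :
    pd i (pd j f) x = pd j (pd i f) x := by
  have hcd := hf.contDiffAt (hΩ.mem_nhds hx)
  have hsymm : IsSymmSndFDerivAt ℝ f x := hcd.isSymmSndFDerivAt (by
    simpa using WithTop.coe_le_coe.2 (le_top : (2 : ℕ∞) ≤ ⊤))
  have hd : DifferentiableAt ℝ (fderiv ℝ f) x :=
    (hcd.fderiv_right (m := (⊤ : ℕ∞)) (by norm_cast)).differentiableAt (by simp)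
  have key : ∀ k l : Fin 4, pd k (pd l f) x =
      fderiv ℝ (fderiv ℝ f) x (EuclideanSpace.single k 1) (EuclideanSpace.single l 1) := by
    intro k l
    have : pd l f = fun y => fderiv ℝ f y (EuclideanSpace.single l 1) := rfl
    rw [this, pd, fderiv_clm_apply hd (differentiableAt_const _)]
    simp
  rw [key, key, hsymm]

end PartialDerivatives

/-- Every closed 1-form with smooth components on a simply connected open set is exact. -/
lemma exists_potential {Ω : Set E4} (hΩ : IsOpen Ω) [SimplyConnectedSpace Ω]
    {A : E4 → Fin 4 → ℝ} (hA : ∀ μ, ContDiffOn ℝ (⊤ : ℕ∞) (fun y => A y μ) Ω)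
    (hclosed : ∀ x ∈ Ω, ∀ μ ν, pd μ (fun y => A y ν) x - pd ν (fun y => A y μ) x = 0) :
    ∃ f : E4 → ℝ, ContDiffOn ℝ (⊤ : ℕ∞) f Ω ∧ ∀ x ∈ Ω, ∀ μ, pd μ f x = A x μ := by
  let ω : E4 → E4 →L[ℝ] ℝ := fun y => ∑ μ, A y μ • (EuclideanSpace.proj μ : E4 →L[ℝ] ℝ)
  have hωsm : ContDiffOn ℝ (⊤ : ℕ∞) ω Ω :=
    ContDiffOn.sum fun μ _ => (hA μ).smul contDiffOn_const
  have hω_single : ∀ y μ, ω y (EuclideanSpace.single μ 1) = A y μ := by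
    intro y μ
    simp [ω]
  have hωd : ∀ a ∈ Ω, ∀ u v, fderiv ℝ ω a u v =
      ∑ μ, ∑ ν, u μ * v ν * pd μ (fun y => A y ν) a := by
    intro a ha u v
    have hd : ∀ μ, DifferentiableAt ℝ (fun y => A y μ) a :=
      fun μ => (hA μ).differentiableAt_of_isOpen hΩ ha
    have hu : u = ∑ μ, u μ • (EuclideanSpace.single μ (1 : ℝ)) := by
      ext i; simp [Finset.sum_apply, Pi.single_apply]
    have h1 : fderiv ℝ ω a u v = ∑ ν, v ν * fderiv ℝ (fun y => A y ν) a u := by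
      have hωa : DifferentiableAt ℝ ω a :=
        (hωsm.contDiffAt (hΩ.mem_nhds ha)).differentiableAt (by simp)
      have happ : fderiv ℝ (fun y => ω y v) a u = fderiv ℝ ω a u v := by
        rw [fderiv_clm_apply hωa (differentiableAt_const _)]
        simp
      have hsum : (fun y => ω y v) = fun y => ∑ ν, A y ν * v ν := by
        funext y
        simp [ω]
      rw [← happ, hsum, fderiv_fun_sum fun ν _ => (hd ν).mul_const _, _root_.sum_apply]
      refine Finset.sum_congr rfl fun ν _ => ?_
      rw [fderiv_mul_const (hd ν)]
      simp
    rw [h1, Finset.sum_comm]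
    refine Finset.sum_congr rfl fun ν _ => ?_
    conv_lhs => rw [hu]
    simp only [map_sum, map_smul, smul_eq_mul, Finset.mul_sum, pd]
    exact Finset.sum_congr rfl fun μ _ => by ring
  obtain ⟨f, hf⟩ := hΩ.exists_hasFDerivAt_of_fderiv_symmetric
    (hωsm.differentiableOn (by simp)) (fun a ha u v => by
      rw [hωd a ha, hωd a ha, Finset.sum_comm]
      refine Finset.sum_congr rfl fun μ _ => Finset.sum_congr rfl fun ν _ => ?_
      rw [sub_eq_zero.1 (hclosed a ha ν μ)]
      ring)
  refine ⟨f, ?_, fun x hx μ => ?_⟩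
  · have h : ContDiffOn ℝ ((⊤ : ℕ∞) + 1) f Ω := by
      rw [contDiffOn_succ_iff_fderiv_of_isOpen hΩ]
      refine ⟨fun x hx => (hf x hx).differentiableAt.differentiableWithinAt, by simp, ?_⟩
      exact hωsm.congr fun x hx => (hf x hx).fderiv
    exact h.of_le (by norm_cast)
  · rw [pd, (hf x hx).fderiv, hω_single]

section PermutationSymbol

lemma epsSymb_eq (a b c d : Fin 4) :
    epsSymb a b c d = (((b : ℕ) - (a : ℕ)) * ((c : ℕ) - (a : ℕ)) * ((d : ℕ) - (a : ℕ)) *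
      ((c : ℕ) - (b : ℕ)) * ((d : ℕ) - (b : ℕ)) * ((d : ℕ) - (c : ℕ)) : ℝ) / 12 := by
  have h : ∀ a b c d : Fin 4,
      12 * Matrix.det (Matrix.of fun i j => if (![a, b, c, d] i) = j then (1 : ℤ) else 0) =
      ((b : ℕ) - (a : ℕ)) * ((c : ℕ) - (a : ℕ)) * ((d : ℕ) - (a : ℕ)) *
      ((c : ℕ) - (b : ℕ)) * ((d : ℕ) - (b : ℕ)) * ((d : ℕ) - (c : ℕ)) := by
    intro a b c d
    simp only [Matrix.det_succ_row_zero, Fin.sum_univ_succ]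
    revert a b c d
    decide +kernel
  have hcast : epsSymb a b c d = ((Matrix.det (Matrix.of fun i j =>
      if (![a, b, c, d] i) = j then (1 : ℤ) else 0) : ℤ) : ℝ) := by
    rw [epsSymb, Int.cast_det]
    congr 1
    ext i j
    simp
  rw [hcast, eq_div_iff (by norm_num), mul_comm]
  exact_mod_cast h a b c d

variable {P : Fin 4 → Fin 4 → ℝ}

lemma lie_dual (B : Fin 4 → Fin 4 → ℝ) (μ ν : Fin 4) :
    (1 / 2) * ∑ a, ∑ b, (-(∑ s, B s s) * P a b + ∑ s, B s a * P s b + ∑ s, B s b * P a s) *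
        epsSymb a b μ ν +
      ∑ s, ((1 / 2) * (∑ a, ∑ b, P a b * epsSymb a b s ν) * B μ s +
        (1 / 2) * (∑ a, ∑ b, P a b * epsSymb a b μ s) * B ν s) = 0 := by
  fin_cases μ <;> fin_cases ν <;>
  · simp [Fin.sum_univ_four, epsSymb_eq]
    ring

lemma dual_apply (hP : ∀ a b, P a b = -P b a) (μ ν : Fin 4) :
    (1 / 2) * ∑ a, ∑ b, P a b * epsSymb a b μ ν =
      ![![0, P 2 3, -P 1 3, P 1 2], ![-P 2 3, 0, P 0 3, -P 0 2],
        ![P 1 3, -P 0 3, 0, P 0 1], ![-P 1 2, P 0 2, -P 0 1, 0]] μ ν := by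
  have h1 : P 1 0 = -P 0 1 ∧ P 2 0 = -P 0 2 ∧ P 3 0 = -P 0 3 ∧
      P 2 1 = -P 1 2 ∧ P 3 1 = -P 1 3 ∧ P 3 2 = -P 2 3 :=
    ⟨hP .., hP .., hP .., hP .., hP .., hP ..⟩
  fin_cases μ <;> fin_cases ν <;>
  · simp [Fin.sum_univ_four, epsSymb_eq, h1]
    try ring

/-- The divergence form of `d ∗`: here `D c a b` stands for `∂_c P^{ab}`. -/
lemma cyclic_dual {D : Fin 4 → Fin 4 → Fin 4 → ℝ} (hD : ∀ c a b, D c a b = -D c b a)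
    (c μ ν : Fin 4) :
    (1 / 2) * (∑ a, ∑ b, D c a b * epsSymb a b μ ν) +
      (1 / 2) * (∑ a, ∑ b, D μ a b * epsSymb a b ν c) +
      (1 / 2) * (∑ a, ∑ b, D ν a b * epsSymb a b c μ) =
      -∑ b, (∑ a, D a a b) * epsSymb b c μ ν := by
  have h0 : ∀ c a, D c a a = 0 := fun c a => by linarith [hD c a a]
  have h1 : ∀ c, D c 1 0 = -D c 0 1 ∧ D c 2 0 = -D c 0 2 ∧ D c 3 0 = -D c 0 3 ∧
      D c 2 1 = -D c 1 2 ∧ D c 3 1 = -D c 1 3 ∧ D c 3 2 = -D c 2 3 := fun c =>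
    ⟨hD .., hD .., hD .., hD .., hD .., hD ..⟩
  simp only [dual_apply (hD _)]
  fin_cases c <;> fin_cases μ <;> fin_cases ν <;>
  · simp [Fin.sum_univ_four, epsSymb_eq, h0, h1]
    try ring

lemma wedge_dual {Q : Fin 4 → Fin 4 → ℝ} (hQ : ∀ a b, Q a b = -Q b a) {α ξ : Fin 4 → ℝ}
    (hαξ : ∑ c, α c * ξ c = 0) (k : ℝ) (μ ν : Fin 4) :
    ∑ c, ξ c * ∑ b, (-4 * (∑ d, Q b d * α d) + k * ξ b) * epsSymb b c μ ν =
      4 * (α μ * (∑ c, ξ c * ((1 / 2) * ∑ a, ∑ b, Q a b * epsSymb a b c ν)) -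
        α ν * (∑ c, ξ c * ((1 / 2) * ∑ a, ∑ b, Q a b * epsSymb a b c μ))) := by
  set X : Fin 4 → ℝ := fun b => ∑ d, Q b d * α d with hX
  have h0 : ∀ a, Q a a = 0 := fun a => by linarith [hQ a a]
  have h1 : Q 1 0 = -Q 0 1 ∧ Q 2 0 = -Q 0 2 ∧ Q 3 0 = -Q 0 3 ∧
      Q 2 1 = -Q 1 2 ∧ Q 3 1 = -Q 1 3 ∧ Q 3 2 = -Q 2 3 :=
    ⟨hQ .., hQ .., hQ .., hQ .., hQ .., hQ ..⟩
  have hl : ∑ c, ξ c * ∑ b, (-4 * X b + k * ξ b) * epsSymb b c μ ν =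
      -4 * ((1 / 2) * ∑ a, ∑ b, (X a * ξ b - X b * ξ a) * epsSymb a b μ ν) := by
    fin_cases μ <;> fin_cases ν <;>
    · simp [Fin.sum_univ_four, epsSymb_eq]
      try ring
  rw [Fin.sum_univ_four] at hαξ
  change ∑ c, ξ c * ∑ b, (-4 * X b + k * ξ b) * epsSymb b c μ ν = _
  rw [hl, dual_apply (fun a b => by ring)]
  simp only [dual_apply hQ]
  fin_cases μ <;> fin_cases ν <;>
    simp [Fin.sum_univ_four, h0, h1, hX]
  all_goals first
    | ring1
    | linear_combination 4 * Q 0 1 * hαξ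
    | linear_combination 4 * Q 0 2 * hαξ
    | linear_combination 4 * Q 0 3 * hαξ
    | linear_combination 4 * Q 1 2 * hαξ
    | linear_combination 4 * Q 1 3 * hαξ
    | linear_combination 4 * Q 2 3 * hαξ
    | linear_combination -4 * Q 0 1 * hαξ
    | linear_combination -4 * Q 0 2 * hαξ
    | linear_combination -4 * Q 0 3 * hαξ
    | linear_combination -4 * Q 1 2 * hαξ
    | linear_combination -4 * Q 1 3 * hαξ
    | linear_combination -4 * Q 2 3 * hαξ

end PermutationSymbol

/-- The partial derivative `∂_i M(x)` of a matrix-valued function. -/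
noncomputable def pdMatrix (i : Fin 4) (M : E4 → Matrix (Fin 4) (Fin 4) ℝ) (x : E4) :
    Matrix (Fin 4) (Fin 4) ℝ :=
  Matrix.of fun a b => pd i (fun y => M y a b) x

section PdMatrix

variable {x : E4} {M N : E4 → Matrix (Fin 4) (Fin 4) ℝ}

lemma pdMatrix_apply (i : Fin 4) (M : E4 → Matrix (Fin 4) (Fin 4) ℝ) (x : E4) (a b : Fin 4) :
    pdMatrix i M x a b = pd i (fun y => M y a b) x :=
  rfl

lemma pdMatrix_transpose (i : Fin 4) : pdMatrix i (fun y => (M y)ᵀ) x = (pdMatrix i M x)ᵀ :=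
  rfl

lemma pdMatrix_mul (hM : ∀ a b, DifferentiableAt ℝ (fun y => M y a b) x)
    (hN : ∀ a b, DifferentiableAt ℝ (fun y => N y a b) x) (i : Fin 4) :
    pdMatrix i (fun y => M y * N y) x = pdMatrix i M x * N x + M x * pdMatrix i N x := by
  ext a b
  simp only [pdMatrix_apply, Matrix.add_apply, Matrix.mul_apply]
  rw [pd_sum fun c _ => (hM _ _).fun_mul (hN _ _), ← Finset.sum_add_distrib]
  refine Finset.sum_congr rfl fun c _ => ?_
  rw [pd_mul (hM _ _) (hN _ _)]
  ring

lemma pdMatrix_smul {f : E4 → ℝ} (hf : DifferentiableAt ℝ f x)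
    (hM : ∀ a b, DifferentiableAt ℝ (fun y => M y a b) x) (i : Fin 4) :
    pdMatrix i (fun y => f y • M y) x = pd i f x • M x + f x • pdMatrix i M x := by
  ext a b
  simp only [pdMatrix_apply, Matrix.add_apply, Matrix.smul_apply, smul_eq_mul]
  rw [pd_mul hf (hM _ _)]
  ring

lemma contDiffOn_matrix_mul {Ω : Set E4} (hM : ∀ a b, ContDiffOn ℝ (⊤ : ℕ∞) (fun y => M y a b) Ω)
    (hN : ∀ a b, ContDiffOn ℝ (⊤ : ℕ∞) (fun y => N y a b) Ω) (a b : Fin 4) :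
    ContDiffOn ℝ (⊤ : ℕ∞) (fun y => (M y * N y) a b) Ω := by
  simp only [Matrix.mul_apply]
  exact ContDiffOn.sum fun c _ => (hM _ _).mul (hN _ _)

end PdMatrix

section Metric

variable {Ω : Set E4} {g : E4 → Matrix (Fin 4) (Fin 4) ℝ} {x : E4}

lemma pd_prod {ι : Type*} [DecidableEq ι] {s : Finset ι} {u : ι → E4 → ℝ}
    (hu : ∀ j ∈ s, DifferentiableAt ℝ (u j) x) (i : Fin 4) :
    pd i (fun y => ∏ j ∈ s, u j y) x = ∑ j ∈ s, (∏ k ∈ s.erase j, u k x) * pd i (u j) x := by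
  simp [pd, fderiv_finsetProd hu]

lemma contDiffOn_det (hg : ∀ μ ν, ContDiffOn ℝ (⊤ : ℕ∞) (fun y => g y μ ν) Ω) :
    ContDiffOn ℝ (⊤ : ℕ∞) (fun y => (g y).det) Ω := by
  simp only [Matrix.det_apply']
  exact ContDiffOn.sum fun σ _ => contDiffOn_const.mul (contDiffOn_prod fun i _ => hg _ _)

lemma pd_det (hg : ∀ μ ν, DifferentiableAt ℝ (fun y => g y μ ν) x) (i : Fin 4) :
    pd i (fun y => (g y).det) x =
      ∑ a, ∑ b, (g x).adjugate a b * pd i (fun y => g y b a) x := by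
  have h : ∀ a, ∑ b, (g x).adjugate a b * pd i (fun y => g y b a) x =
      ((g x).updateCol a fun b => pd i (fun y => g y b a) x).det := by
    intro a
    rw [← Matrix.cramer_apply, Matrix.cramer_eq_adjugate_mulVec]
    rfl
  have hu : ∀ σ : Equiv.Perm (Fin 4), DifferentiableAt ℝ (fun y => ∏ j, g y (σ j) j) x :=
    fun σ => (HasFDerivAt.finsetProd fun j _ => (hg (σ j) j).hasFDerivAt).differentiableAt
  simp only [h, Matrix.det_apply']
  rw [pd_sum fun σ _ => (hu σ).const_mul _, Finset.sum_comm]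
  refine Finset.sum_congr rfl fun σ _ => ?_
  rw [pd_const_mul (hu σ), pd_prod fun j _ => hg _ _, Finset.mul_sum]
  refine Finset.sum_congr rfl fun a _ => ?_
  rw [← Finset.mul_prod_erase Finset.univ _ (Finset.mem_univ a), Matrix.updateCol_self,
    mul_comm (pd i _ x)]
  congr 2
  refine Finset.prod_congr rfl fun k hk => ?_
  rw [Matrix.updateCol_ne (Finset.ne_of_mem_erase hk)]

lemma contDiffOn_ginv (hg : ∀ μ ν, ContDiffOn ℝ (⊤ : ℕ∞) (fun y => g y μ ν) Ω)
    (hdet : ∀ x ∈ Ω, IsUnit (g x).det) (a b : Fin 4) :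
    ContDiffOn ℝ (⊤ : ℕ∞) (fun y => ginv g y a b) Ω := by
  simp only [ginv, Matrix.inv_def, Ring.inverse_eq_inv', Matrix.smul_apply, Matrix.adjugate_apply]
  refine ((contDiffOn_det hg).inv fun y hy => (hdet y hy).ne_zero).smul
    (contDiffOn_det fun μ ν => ?_)
  by_cases h : μ = b
  · subst h
    simp only [Matrix.updateRow_self]
    exact contDiffOn_const
  · simp only [Matrix.updateRow_ne h]
    exact hg _ _

lemma ginv_mul_self (hdet : IsUnit (g x).det) : ginv g x * g x = 1 :=
  Matrix.nonsing_inv_mul _ hdet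

lemma mul_ginv_self (hdet : IsUnit (g x).det) : g x * ginv g x = 1 :=
  Matrix.mul_nonsing_inv _ hdet

lemma ginv_isSymm (hs : (g x).IsSymm) : (ginv g x).IsSymm := by
  rw [Matrix.IsSymm, ginv, Matrix.transpose_nonsing_inv, hs.eq]

lemma hasDerivAt_sqrt_abs {t : ℝ} (ht : t ≠ 0) :
    HasDerivAt (fun t => Real.sqrt |t|) (Real.sqrt |t| / (2 * t)) t := by
  have h := (hasDerivAt_abs ht).sqrt (abs_ne_zero.2 ht)
  convert h using 1
  have h1 : Real.sqrt |t| ≠ 0 := (Real.sqrt_pos.2 (abs_pos.2 ht)).ne'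
  rw [div_eq_div_iff (by simpa) (by simpa)]
  have h2 : Real.sqrt |t| * Real.sqrt |t| = |t| := Real.mul_self_sqrt (abs_nonneg t)
  have h3 : (SignType.sign t : ℝ) * t = |t| := sign_mul_self t
  linear_combination 2 * h2 - 2 * h3

lemma contDiffOn_vol (hg : ∀ μ ν, ContDiffOn ℝ (⊤ : ℕ∞) (fun y => g y μ ν) Ω)
    (hdet : ∀ x ∈ Ω, IsUnit (g x).det) : ContDiffOn ℝ (⊤ : ℕ∞) (vol g) Ω := by
  intro y hy
  have h0 : (g y).det ≠ 0 := (hdet y hy).ne_zero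
  exact (((contDiffOn_det hg) y hy).abs h0).sqrt (abs_ne_zero.2 h0)

lemma pd_vol (hΩ : IsOpen Ω) (hx : x ∈ Ω)
    (hg : ∀ μ ν, ContDiffOn ℝ (⊤ : ℕ∞) (fun y => g y μ ν) Ω)
    (hdet : IsUnit (g x).det) (i : Fin 4) :
    pd i (vol g) x = vol g x / 2 * (ginv g x * pdMatrix i g x).trace := by
  have h0 : (g x).det ≠ 0 := hdet.ne_zero
  have h1 := (hasDerivAt_sqrt_abs h0).comp_hasFDerivAt x
    ((contDiffOn_det hg).differentiableAt_of_isOpen hΩ hx).hasFDerivAt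
  have h2 : pd i (vol g) x = Real.sqrt |(g x).det| / (2 * (g x).det) *
      pd i (fun y => (g y).det) x := by
    have : vol g = (fun t => Real.sqrt |t|) ∘ fun y => (g y).det := rfl
    rw [pd, this, h1.fderiv]
    simp [pd]
  rw [h2, pd_det fun μ ν => (hg μ ν).differentiableAt_of_isOpen hΩ hx]
  have h3 : (ginv g x * pdMatrix i g x).trace = (g x).det⁻¹ *
      ∑ a, ∑ b, (g x).adjugate a b * pd i (fun y => g y b a) x := by
    rw [ginv, Matrix.inv_def, Ring.inverse_eq_inv', Matrix.smul_mul, Matrix.trace_smul]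
    rfl
  rw [h3, vol]
  field_simp

lemma pdMatrix_ginv (hΩ : IsOpen Ω) (hx : x ∈ Ω)
    (hg : ∀ μ ν, ContDiffOn ℝ (⊤ : ℕ∞) (fun y => g y μ ν) Ω)
    (hdet : ∀ x ∈ Ω, IsUnit (g x).det) (i : Fin 4) :
    pdMatrix i (ginv g) x = -(ginv g x * pdMatrix i g x * ginv g x) := by
  have hd := fun μ ν => (hg μ ν).differentiableAt_of_isOpen hΩ hx
  have hGd := fun μ ν => (contDiffOn_ginv hg hdet μ ν).differentiableAt_of_isOpen hΩ hx
  have h1 : pdMatrix i (ginv g) x * g x + ginv g x * pdMatrix i g x = 0 := by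
    rw [← pdMatrix_mul hGd hd]
    ext a b
    have h := pd_congr hΩ hx (h := fun _ => (1 : Matrix (Fin 4) (Fin 4) ℝ) a b)
      (fun y hy => congrFun (congrFun (ginv_mul_self (hdet y hy)) a) b) i
    rwa [pd_const] at h
  have h2 := congrArg (· * ginv g x) h1
  simp only [add_mul, zero_mul, mul_assoc, mul_ginv_self (hdet x hx), mul_one] at h2
  rw [mul_assoc]
  exact eq_neg_of_add_eq_zero_left h2

end Metric

/-- The densitized contravariant components `√|det g| K^{ab}` of a covariant 2-tensor `K`. -/
noncomputable def raise (g K : E4 → Matrix (Fin 4) (Fin 4) ℝ) (x : E4) :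
    Matrix (Fin 4) (Fin 4) ℝ :=
  vol g x • (ginv g x * K x * (ginv g x)ᵀ)

section Raise

variable {Ω : Set E4} {g K : E4 → Matrix (Fin 4) (Fin 4) ℝ} {ξ : E4 → Fin 4 → ℝ} {x : E4}

lemma star2_eq (x : E4) (μ ν : Fin 4) :
    star2 g K x μ ν = (1 / 2) * ∑ a, ∑ b, raise g K x a b * epsSymb a b μ ν := by
  have h : ∀ a b, raise g K x a b =
      vol g x * ∑ c, ∑ d, ginv g x a c * ginv g x b d * K x c d := by
    intro a b
    simp only [raise, Matrix.smul_apply, Matrix.mul_apply, Matrix.transpose_apply, smul_eq_mul,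
      Finset.sum_mul]
    rw [Finset.sum_comm]
    congr 1
    exact Finset.sum_congr rfl fun c _ => Finset.sum_congr rfl fun d _ => by ring
  simp only [star2, h, mul_assoc, ← Finset.mul_sum]
  ring

lemma raise_anti (hK : (K x)ᵀ = -K x) (a b : Fin 4) : raise g K x a b = -raise g K x b a := by
  have h : (raise g K x)ᵀ = -raise g K x := by
    simp only [raise, Matrix.transpose_smul, Matrix.transpose_mul, Matrix.transpose_transpose, hK,
      Matrix.mul_neg, Matrix.neg_mul, smul_neg, Matrix.mul_assoc]
  exact congrFun (congrFun h b) a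

lemma contDiffOn_raise (hg : ∀ μ ν, ContDiffOn ℝ (⊤ : ℕ∞) (fun y => g y μ ν) Ω)
    (hdet : ∀ x ∈ Ω, IsUnit (g x).det)
    (hK : ∀ μ ν, ContDiffOn ℝ (⊤ : ℕ∞) (fun y => K y μ ν) Ω) (a b : Fin 4) :
    ContDiffOn ℝ (⊤ : ℕ∞) (fun y => raise g K y a b) Ω :=
  (contDiffOn_vol hg hdet).mul <| contDiffOn_matrix_mul (M := fun y => ginv g y * K y)
    (N := fun y => (ginv g y)ᵀ) (contDiffOn_matrix_mul (contDiffOn_ginv hg hdet) hK)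
    (fun a b => contDiffOn_ginv hg hdet b a) a b

lemma contDiffOn_star2 (hg : ∀ μ ν, ContDiffOn ℝ (⊤ : ℕ∞) (fun y => g y μ ν) Ω)
    (hdet : ∀ x ∈ Ω, IsUnit (g x).det)
    (hK : ∀ μ ν, ContDiffOn ℝ (⊤ : ℕ∞) (fun y => K y μ ν) Ω) (μ ν : Fin 4) :
    ContDiffOn ℝ (⊤ : ℕ∞) (fun y => star2 g K y μ ν) Ω := by
  simp only [star2_eq]
  exact contDiffOn_const.mul <| ContDiffOn.sum fun a _ => ContDiffOn.sum fun b _ =>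
    (contDiffOn_raise hg hdet hK a b).mul contDiffOn_const

lemma pd_star2 (hΩ : IsOpen Ω) (hx : x ∈ Ω)
    (hg : ∀ μ ν, ContDiffOn ℝ (⊤ : ℕ∞) (fun y => g y μ ν) Ω)
    (hdet : ∀ x ∈ Ω, IsUnit (g x).det)
    (hK : ∀ μ ν, ContDiffOn ℝ (⊤ : ℕ∞) (fun y => K y μ ν) Ω) (i μ ν : Fin 4) :
    pd i (fun y => star2 g K y μ ν) x =
      (1 / 2) * ∑ a, ∑ b, pdMatrix i (raise g K) x a b * epsSymb a b μ ν := by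
  have hd := fun a b => (contDiffOn_raise hg hdet hK a b).differentiableAt_of_isOpen hΩ hx
  simp only [star2_eq]
  rw [pd_const_mul (DifferentiableAt.fun_sum fun a _ => DifferentiableAt.fun_sum fun b _ =>
    (hd a b).mul_const _), pd_sum fun a _ => DifferentiableAt.fun_sum fun b _ =>
    (hd a b).mul_const _]
  congr 1
  refine Finset.sum_congr rfl fun a _ => ?_
  rw [pd_sum fun b _ => (hd a b).mul_const _]
  exact Finset.sum_congr rfl fun b _ => pd_mul_const (hd a b) _ i

/-- The matrix `∂_μ ξ^s`. -/
noncomputable def gradMatrix (ξ : E4 → Fin 4 → ℝ) (x : E4) : Matrix (Fin 4) (Fin 4) ℝ :=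
  Matrix.of fun μ s => pd μ (fun y => ξ y s) x

lemma sum_smul_pdMatrix_of_lieD (hK : ∀ μ ν, lieD ξ K x μ ν = 0) :
    ∑ s, ξ x s • pdMatrix s K x = -(gradMatrix ξ x * K x + K x * (gradMatrix ξ x)ᵀ) := by
  ext μ ν
  have h := hK μ ν
  simp only [lieD, Finset.sum_add_distrib] at h
  simp only [Matrix.sum_apply, Matrix.smul_apply, smul_eq_mul, pdMatrix_apply, Matrix.neg_apply,
    Matrix.add_apply, Matrix.mul_apply, Matrix.transpose_apply, gradMatrix, Matrix.of_apply]
  simp only [mul_comm (K x _ ν)] at h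
  linarith

lemma sum_smul_pdMatrix_raise (hΩ : IsOpen Ω) (hx : x ∈ Ω)
    (hg : ∀ μ ν, ContDiffOn ℝ (⊤ : ℕ∞) (fun y => g y μ ν) Ω)
    (hdet : ∀ x ∈ Ω, IsUnit (g x).det) (hs : (g x).IsSymm)
    (hK : ∀ μ ν, ContDiffOn ℝ (⊤ : ℕ∞) (fun y => K y μ ν) Ω)
    (hLg : ∀ μ ν, lieD ξ g x μ ν = 0) (hLK : ∀ μ ν, lieD ξ K x μ ν = 0) :
    ∑ s, ξ x s • pdMatrix s (raise g K) x = -(gradMatrix ξ x).trace • raise g K x +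
      (gradMatrix ξ x)ᵀ * raise g K x + raise g K x * gradMatrix ξ x := by
  have hGd := fun a b => (contDiffOn_ginv hg hdet a b).differentiableAt_of_isOpen hΩ hx
  have hKd := fun a b => (hK a b).differentiableAt_of_isOpen hΩ hx
  have hvd := (contDiffOn_vol hg hdet).differentiableAt_of_isOpen hΩ hx
  have hGKd := fun a b => (contDiffOn_matrix_mul (contDiffOn_ginv hg hdet) hK
    a b).differentiableAt_of_isOpen hΩ hx
  have hGKGd := fun a b => (contDiffOn_matrix_mul (M := fun y => ginv g y * K y)
    (N := fun y => (ginv g y)ᵀ) (contDiffOn_matrix_mul (contDiffOn_ginv hg hdet) hK)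
    (fun a b => contDiffOn_ginv hg hdet b a) a b).differentiableAt_of_isOpen hΩ hx
  have hraise : ∀ s, pdMatrix s (raise g K) x =
      pd s (vol g) x • (ginv g x * K x * (ginv g x)ᵀ) + vol g x •
        ((pdMatrix s (ginv g) x * K x + ginv g x * pdMatrix s K x) * (ginv g x)ᵀ +
          ginv g x * K x * (pdMatrix s (ginv g) x)ᵀ) := by
    intro s
    change pdMatrix s (fun y => vol g y • (ginv g y * K y * (ginv g y)ᵀ)) x = _
    rw [pdMatrix_smul hvd hGKGd, pdMatrix_mul (N := fun y => (ginv g y)ᵀ) hGKd (fun a b => hGd b a), pdMatrix_mul hGd hKd,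
      pdMatrix_transpose]
  set B := gradMatrix ξ x with hB
  set G := ginv g x with hG
  have hGg : G * g x = 1 := ginv_mul_self (hdet x hx)
  have hgG : g x * G = 1 := mul_ginv_self (hdet x hx)
  have hLg' := sum_smul_pdMatrix_of_lieD hLg
  have hLK' := sum_smul_pdMatrix_of_lieD hLK
  have hLG : ∑ s, ξ x s • pdMatrix s (ginv g) x = G * B + Bᵀ * G := by
    have h1 : ∑ s, ξ x s • pdMatrix s (ginv g) x = -(G * (∑ s, ξ x s • pdMatrix s g x) * G) := by
      simp only [pdMatrix_ginv hΩ hx hg hdet, Finset.mul_sum, Finset.sum_mul, Matrix.mul_smul,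
        Matrix.smul_mul, smul_neg, Finset.sum_neg_distrib, ← hG]
    rw [h1, hLg']
    simp only [mul_neg, neg_mul, neg_neg, mul_add, add_mul, mul_assoc, hgG, mul_one]
    rw [← mul_assoc G (g x), hGg, one_mul]
  have hLv : ∑ s, ξ x s * pd s (vol g) x = -B.trace * vol g x := by
    have h1 : ∑ s, ξ x s * pd s (vol g) x =
        vol g x / 2 * (G * ∑ s, ξ x s • pdMatrix s g x).trace := by
      simp only [pd_vol hΩ hx hg (hdet x hx), Finset.mul_sum, Matrix.mul_smul, Matrix.trace_sum,
        Matrix.trace_smul, smul_eq_mul, ← hG]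
      exact Finset.sum_congr rfl fun s _ => by ring
    rw [h1, hLg', mul_neg, mul_add, Matrix.trace_neg, Matrix.trace_add, Matrix.trace_mul_comm,
      mul_assoc B, hgG, ← mul_assoc, hGg, mul_one, one_mul, Matrix.trace_transpose]
    ring
  have hsum : ∑ s, ξ x s • pdMatrix s (raise g K) x =
      (∑ s, ξ x s * pd s (vol g) x) • (G * K x * Gᵀ) + vol g x •
        (((∑ s, ξ x s • pdMatrix s (ginv g) x) * K x + G * ∑ s, ξ x s • pdMatrix s K x) * Gᵀ +
          G * K x * (∑ s, ξ x s • pdMatrix s (ginv g) x)ᵀ) := by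
    simp only [hraise, Finset.sum_smul, Matrix.transpose_sum, Matrix.transpose_smul,
      Finset.sum_mul, Finset.mul_sum, Matrix.smul_mul, Matrix.mul_smul, ← Finset.sum_add_distrib,
      Finset.smul_sum]
    refine Finset.sum_congr rfl fun s _ => ?_
    simp only [Matrix.add_mul, smul_add, smul_smul, Matrix.smul_mul, mul_comm (vol g x)]
    
  rw [hsum, hLv, hLG, hLK']
  simp only [raise, ← hG, ← hB, Matrix.transpose_add, Matrix.transpose_mul,
    Matrix.transpose_transpose, Matrix.mul_smul, Matrix.smul_mul, smul_smul]
  rw [add_assoc, ← smul_add]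
  congr 2
  have : Gᵀ = G := ginv_isSymm hs
  rw [this]
  noncomm_ring

/-- The Hodge star is invariant along a Killing field. -/
lemma lieD_star2 (hΩ : IsOpen Ω) (hx : x ∈ Ω)
    (hg : ∀ μ ν, ContDiffOn ℝ (⊤ : ℕ∞) (fun y => g y μ ν) Ω)
    (hdet : ∀ x ∈ Ω, IsUnit (g x).det) (hs : (g x).IsSymm)
    (hK : ∀ μ ν, ContDiffOn ℝ (⊤ : ℕ∞) (fun y => K y μ ν) Ω)
    (hLg : ∀ μ ν, lieD ξ g x μ ν = 0) (hLK : ∀ μ ν, lieD ξ K x μ ν = 0) (μ ν : Fin 4) :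
    lieD ξ (fun y => Matrix.of (star2 g K y)) x μ ν = 0 := by
  rw [← lie_dual (P := raise g K x) (gradMatrix ξ x) μ ν]
  have h := sum_smul_pdMatrix_raise hΩ hx hg hdet hs hK hLg hLK
  have h' : ∀ a b, ∑ s, ξ x s * pdMatrix s (raise g K) x a b =
      -(∑ s, gradMatrix ξ x s s) * raise g K x a b + ∑ s, gradMatrix ξ x s a * raise g K x s b +
        ∑ s, gradMatrix ξ x s b * raise g K x a s := by
    intro a b
    have := congrFun (congrFun h a) b
    simp only [Matrix.sum_apply, Matrix.smul_apply, smul_eq_mul, Matrix.add_apply,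
      Matrix.mul_apply, Matrix.transpose_apply, Matrix.trace, Matrix.diag_apply] at this
    rw [this]
    simp only [mul_comm (raise g K x a _) (gradMatrix ξ x _ b)]
  have h1 : ∑ s, ξ x s * pd s (fun y => star2 g K y μ ν) x =
      (1 / 2) * ∑ a, ∑ b, (∑ s, ξ x s * pdMatrix s (raise g K) x a b) * epsSymb a b μ ν := by
    simp only [pd_star2 hΩ hx hg hdet hK, Finset.mul_sum, Finset.sum_mul]
    rw [Finset.sum_comm]
    refine Finset.sum_congr rfl fun a _ => ?_
    rw [Finset.sum_comm]
    exact Finset.sum_congr rfl fun b _ => Finset.sum_congr rfl fun s _ => by ring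
  simp only [h'] at h1
  rw [← h1, ← Finset.sum_add_distrib]
  simp only [lieD, Matrix.of_apply, star2_eq, gradMatrix, add_assoc]

end Raise

section Cartan

variable {Ω : Set E4} {g S : E4 → Matrix (Fin 4) (Fin 4) ℝ} {ξ : E4 → Fin 4 → ℝ} {x : E4}

/-- Cartan's formula for `d (i_ξ S)` when `L_ξ S = 0`. -/
lemma pd_contract_sub (hΩ : IsOpen Ω) (hx : x ∈ Ω)
    (hξ : ∀ μ, ContDiffOn ℝ (⊤ : ℕ∞) (fun y => ξ y μ) Ω)
    (hS : ∀ μ ν, ContDiffOn ℝ (⊤ : ℕ∞) (fun y => S y μ ν) Ω)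
    (hanti : ∀ y ∈ Ω, ∀ μ ν, S y μ ν = -S y ν μ) (μ ν : Fin 4)
    (hL : lieD ξ S x μ ν = 0) :
    pd μ (fun y => ∑ s, ξ y s * S y s ν) x - pd ν (fun y => ∑ s, ξ y s * S y s μ) x =
      -∑ s, ξ x s * (pd s (fun y => S y μ ν) x + pd μ (fun y => S y ν s) x +
        pd ν (fun y => S y s μ) x) := by
  have hξd := fun s => (hξ s).differentiableAt_of_isOpen hΩ hx
  have hSd := fun a b => (hS a b).differentiableAt_of_isOpen hΩ hx
  have h1 : ∀ s, pd μ (fun y => S y ν s) x = -pd μ (fun y => S y s ν) x := fun s => by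
    rw [pd_congr hΩ hx (fun y hy => hanti y hy ν s), pd_neg]
  have h2 : ∀ s, S x μ s = -S x s μ := fun s => hanti x hx μ s
  rw [pd_sum fun s _ => (hξd s).fun_mul (hSd _ _), pd_sum fun s _ => (hξd s).fun_mul (hSd _ _),
    ← Finset.sum_sub_distrib, ← Finset.sum_neg_distrib, ← sub_eq_zero, ← Finset.sum_sub_distrib,
    ← hL, lieD]
  refine Finset.sum_congr rfl fun s _ => ?_
  rw [pd_mul (hξd s) (hSd _ _), pd_mul (hξd s) (hSd _ _), h1, h2]
  ring

lemma contDiffOn_formOf (hg : ∀ μ ν, ContDiffOn ℝ (⊤ : ℕ∞) (fun y => g y μ ν) Ω)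
    (hξ : ∀ μ, ContDiffOn ℝ (⊤ : ℕ∞) (fun y => ξ y μ) Ω) (μ : Fin 4) :
    ContDiffOn ℝ (⊤ : ℕ∞) (fun y => formOf g ξ y μ) Ω :=
  ContDiffOn.sum fun ν _ => (hg μ ν).mul (hξ ν)

lemma contDiffOn_dform (hΩ : IsOpen Ω)
    (hg : ∀ μ ν, ContDiffOn ℝ (⊤ : ℕ∞) (fun y => g y μ ν) Ω)
    (hξ : ∀ μ, ContDiffOn ℝ (⊤ : ℕ∞) (fun y => ξ y μ) Ω) (μ ν : Fin 4) :
    ContDiffOn ℝ (⊤ : ℕ∞) (fun y => dform g ξ y μ ν) Ω :=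
  ((contDiffOn_formOf hg hξ ν).pd hΩ μ).sub ((contDiffOn_formOf hg hξ μ).pd hΩ ν)

/-- The dual 1-form of a Killing field `ξ` is invariant along `ξ`. -/
lemma lie_formOf (hΩ : IsOpen Ω) (hx : x ∈ Ω)
    (hg : ∀ μ ν, ContDiffOn ℝ (⊤ : ℕ∞) (fun y => g y μ ν) Ω)
    (hξ : ∀ μ, ContDiffOn ℝ (⊤ : ℕ∞) (fun y => ξ y μ) Ω)
    (hL : ∀ μ ν, lieD ξ g x μ ν = 0) (ν : Fin 4) :
    ∑ s, (ξ x s * pd s (fun y => formOf g ξ y ν) x +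
      formOf g ξ x s * pd ν (fun y => ξ y s) x) = 0 := by
  have hξd := fun s => (hξ s).differentiableAt_of_isOpen hΩ hx
  have hgd := fun a b => (hg a b).differentiableAt_of_isOpen hΩ hx
  have h1 : ∑ t, lieD ξ g x ν t * ξ x t = 0 := by simp [hL]
  rw [← h1]
  have h2 : ∀ s, pd s (fun y => formOf g ξ y ν) x =
      ∑ t, (g x ν t * pd s (fun y => ξ y t) x + ξ x t * pd s (fun y => g y ν t) x) := by
    intro s
    simp only [formOf]
    rw [pd_sum fun t _ => (hgd _ _).fun_mul (hξd t)]
    exact Finset.sum_congr rfl fun t _ => pd_mul (hgd _ _) (hξd t) s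
  have h3 : ∑ t, (∑ s, g x ν s * pd t (fun y => ξ y s) x) * ξ x t =
      ∑ s, ξ x s * ∑ t, g x ν t * pd s (fun y => ξ y t) x :=
    Finset.sum_congr rfl fun t _ => mul_comm _ _
  have h4 : ∑ t, (∑ s, ξ x s * pd s (fun y => g y ν t) x) * ξ x t =
      ∑ s, ξ x s * ∑ t, ξ x t * pd s (fun y => g y ν t) x := by
    simp only [Finset.sum_mul, Finset.mul_sum]
    rw [Finset.sum_comm]
    exact Finset.sum_congr rfl fun _ _ => Finset.sum_congr rfl fun _ _ => by ring
  have h5 : ∑ t, (∑ s, g x s t * pd ν (fun y => ξ y s) x) * ξ x t =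
      ∑ s, formOf g ξ x s * pd ν (fun y => ξ y s) x := by
    simp only [formOf, Finset.sum_mul]
    rw [Finset.sum_comm]
    exact Finset.sum_congr rfl fun _ _ => Finset.sum_congr rfl fun _ _ => by ring
  simp only [lieD, h2, Finset.sum_add_distrib, mul_add, add_mul]
  rw [h3, h4, h5]
  ring

/-- The exterior derivative of the dual 1-form of a Killing field `ξ` is invariant along `ξ`. -/
lemma lieD_dform (hΩ : IsOpen Ω) (hx : x ∈ Ω)
    (hg : ∀ μ ν, ContDiffOn ℝ (⊤ : ℕ∞) (fun y => g y μ ν) Ω)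
    (hξ : ∀ μ, ContDiffOn ℝ (⊤ : ℕ∞) (fun y => ξ y μ) Ω)
    (hL : ∀ x ∈ Ω, ∀ μ ν, lieD ξ g x μ ν = 0) (μ ν : Fin 4) :
    lieD ξ (fun y => Matrix.of (dform g ξ y)) x μ ν = 0 := by
  have hξd := fun s => (hξ s).differentiableAt_of_isOpen hΩ hx
  have hη := contDiffOn_formOf hg hξ
  have hηd := fun s => (hη s).differentiableAt_of_isOpen hΩ hx
  have hηd' := fun s t => ((hη s).pd hΩ t).differentiableAt_of_isOpen hΩ hx
  have hξd' := fun s t => ((hξ s).pd hΩ t).differentiableAt_of_isOpen hΩ hx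
  have key : ∀ μ ν, ∑ s, (pd μ (fun y => ξ y s) x * pd s (fun y => formOf g ξ y ν) x +
      ξ x s * pd s (pd μ fun y => formOf g ξ y ν) x +
      pd μ (fun y => formOf g ξ y s) x * pd ν (fun y => ξ y s) x +
      formOf g ξ x s * pd μ (pd ν fun y => ξ y s) x) = 0 := by
    intro μ ν
    have h := pd_congr hΩ hx (fun y hy => lie_formOf hΩ hy hg hξ (hL y hy) ν) μ
    rw [pd_const, pd_sum fun s _ =>
      ((hξd s).fun_mul (hηd' ν s)).fun_add ((hηd s).fun_mul (hξd' s ν))] at h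
    rw [← h]
    refine Finset.sum_congr rfl fun s _ => ?_
    rw [pd_add ((hξd s).fun_mul (hηd' ν s)) ((hηd s).fun_mul (hξd' s ν)),
      pd_mul (hξd s) (hηd' ν s), pd_mul (hηd s) (hξd' s ν), pd_comm (hη ν) hΩ hx μ s]
    ring
  have h1 := key μ ν
  have h2 := key ν μ
  rw [← sub_eq_zero.2 (h1.trans h2.symm), lieD, ← Finset.sum_sub_distrib]
  refine Finset.sum_congr rfl fun s _ => ?_
  simp only [Matrix.of_apply, dform]
  rw [pd_sub (hηd' ν μ) (hηd' μ ν), pd_comm (hξ s) hΩ hx ν μ]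
  ring

lemma star2_anti (x : E4) (μ ν : Fin 4) : star2 g S x μ ν = -star2 g S x ν μ := by
  simp only [star2_eq, Finset.mul_sum, ← Finset.sum_neg_distrib]
  refine Finset.sum_congr rfl fun a _ => Finset.sum_congr rfl fun b _ => ?_
  rw [epsSymb_eq, epsSymb_eq]
  ring

lemma sum_epsSymb_cyclic (R : Fin 4 → Fin 4 → ℝ) (v : Fin 4 → ℝ) (μ : Fin 4) :
    ∑ a, ∑ b, ∑ c, (R a b * v c + R b c * v a + R c a * v b) * epsSymb a b c μ =
      3 * ∑ a, ∑ b, ∑ c, R a b * v c * epsSymb a b c μ := by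
  have h1 : ∀ a b c, epsSymb b c a μ = epsSymb a b c μ := fun a b c => by
    rw [epsSymb_eq, epsSymb_eq]
    ring
  have h2 : ∑ a, ∑ b, ∑ c, R b c * v a * epsSymb a b c μ =
      ∑ a, ∑ b, ∑ c, R a b * v c * epsSymb a b c μ := by
    rw [Finset.sum_comm]
    refine Finset.sum_congr rfl fun b _ => ?_
    rw [Finset.sum_comm]
    exact Finset.sum_congr rfl fun c _ => Finset.sum_congr rfl fun a _ => by rw [h1 a b c]
  have h3 : ∑ a, ∑ b, ∑ c, R c a * v b * epsSymb a b c μ =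
      ∑ a, ∑ b, ∑ c, R b c * v a * epsSymb a b c μ := by
    rw [Finset.sum_comm]
    refine Finset.sum_congr rfl fun b _ => ?_
    rw [Finset.sum_comm]
    exact Finset.sum_congr rfl fun c _ => Finset.sum_congr rfl fun a _ => by rw [h1 a b c]
  simp only [add_mul, Finset.sum_add_distrib]
  rw [h3, h2]
  ring

lemma sum_ginv_mul_formOf (hdet : IsUnit (g x).det) (a : Fin 4) :
    ∑ b, ginv g x a b * formOf g ξ x b = ξ x a := by
  have h := congrFun (congrArg (· *ᵥ ξ x) (ginv_mul_self hdet)) a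
  simp only [← Matrix.mulVec_mulVec, Matrix.one_mulVec] at h
  exact h

/-- The twist 1-form is the contraction of `∗ dξ` with `ξ`. -/
lemma twistF_eq (hdet : IsUnit (g x).det) (μ : Fin 4) :
    twistF g ξ x μ = ∑ c, ξ x c * star2 g (fun y => Matrix.of (dform g ξ y)) x c μ := by
  set R : Fin 4 → Fin 4 → ℝ := fun a b =>
    ∑ p, ∑ q, ginv g x a p * ginv g x b q * dform g ξ x p q with hR
  have hW : ∀ a b c, ∑ p, ∑ q, ∑ r, ginv g x a p * ginv g x b q * ginv g x c r *
      dxiWedgeXi g ξ x p q r = R a b * ξ x c + R b c * ξ x a + R c a * ξ x b := by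
    intro a b c
    simp only [← sum_ginv_mul_formOf (ξ := ξ) hdet, hR, dxiWedgeXi, mul_add,
      Finset.sum_add_distrib, Finset.sum_mul]
    congr 1
    · congr 1
      · refine Finset.sum_congr rfl fun p _ => Finset.sum_congr rfl fun q _ => ?_
        rw [Finset.mul_sum]
        exact Finset.sum_congr rfl fun r _ => by ring
      · rw [Finset.sum_comm]
        refine Finset.sum_congr rfl fun q _ => ?_
        rw [Finset.sum_comm]
        refine Finset.sum_congr rfl fun r _ => ?_
        rw [Finset.mul_sum]
        exact Finset.sum_congr rfl fun p _ => by ring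
    · rw [Finset.sum_congr rfl fun p _ => Finset.sum_comm, Finset.sum_comm]
      refine Finset.sum_congr rfl fun r _ => Finset.sum_congr rfl fun p _ => ?_
      rw [Finset.mul_sum]
      exact Finset.sum_congr rfl fun q _ => by ring
  have hsum : ∑ a, ∑ b, ∑ c, R a b * ξ x c * epsSymb a b c μ =
      ∑ c, ξ x c * ∑ a, ∑ b, R a b * epsSymb a b c μ := by
    simp only [Finset.mul_sum]
    symm
    rw [Finset.sum_comm]
    refine Finset.sum_congr rfl fun a _ => ?_
    rw [Finset.sum_comm]
    exact Finset.sum_congr rfl fun b _ => Finset.sum_congr rfl fun c _ => by ring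
  have hstar : ∀ c, star2 g (fun y => Matrix.of (dform g ξ y)) x c μ =
      vol g x / 2 * ∑ a, ∑ b, R a b * epsSymb a b c μ := fun c => rfl
  simp only [twistF, star3, hW, sum_epsSymb_cyclic, hstar, hsum, mul_left_comm (ξ x _),
    ← Finset.mul_sum]
  ring

end Cartan

section LeviCivita

variable {Ω : Set E4} {g : E4 → Matrix (Fin 4) (Fin 4) ℝ} {ξ : E4 → Fin 4 → ℝ} {x : E4}

lemma Christoffel_symm (hΩ : IsOpen Ω) (hx : x ∈ Ω) (hs : ∀ y ∈ Ω, (g y).IsSymm)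
    (s μ ν : Fin 4) : Christoffel g x s μ ν = Christoffel g x s ν μ := by
  simp only [Christoffel]
  congr 1
  refine Finset.sum_congr rfl fun l _ => ?_
  rw [pd_congr hΩ hx (fun y hy => (hs y hy).apply ν μ) l]
  ring

lemma contDiffOn_Christoffel (hΩ : IsOpen Ω)
    (hg : ∀ μ ν, ContDiffOn ℝ (⊤ : ℕ∞) (fun y => g y μ ν) Ω)
    (hdet : ∀ y ∈ Ω, IsUnit (g y).det) (s μ ν : Fin 4) :
    ContDiffOn ℝ (⊤ : ℕ∞) (fun y => Christoffel g y s μ ν) Ω :=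
  contDiffOn_const.mul (ContDiffOn.sum fun l _ => (contDiffOn_ginv hg hdet s l).mul
    ((((hg ν l).pd hΩ μ).add ((hg μ l).pd hΩ ν)).sub ((hg μ ν).pd hΩ l)))

/-- The Christoffel symbols with the upper index lowered. -/
lemma sum_mul_Christoffel (hdet : IsUnit (g x).det) (l μ ν : Fin 4) :
    ∑ s, g x l s * Christoffel g x s μ ν = (1 / 2) * (pd μ (fun y => g y ν l) x +
      pd ν (fun y => g y μ l) x - pd l (fun y => g y μ ν) x) := by
  have h := congrFun (congrArg (· *ᵥ fun l => pd μ (fun y => g y ν l) x +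
      pd ν (fun y => g y μ l) x - pd l (fun y => g y μ ν) x) (mul_ginv_self hdet)) l
  simp only [← Matrix.mulVec_mulVec, Matrix.one_mulVec] at h
  rw [← h]
  simp only [Matrix.mulVec, dotProduct, Christoffel, Finset.mul_sum]
  exact Finset.sum_congr rfl fun s _ => Finset.sum_congr rfl fun t _ => by ring

/-- The Levi-Civita connection is metric. -/
lemma pd_metric (hΩ : IsOpen Ω) (hx : x ∈ Ω) (hs : ∀ y ∈ Ω, (g y).IsSymm)
    (hdet : IsUnit (g x).det) (a b c : Fin 4) :
    pd a (fun y => g y b c) x =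
      ∑ t, (g x c t * Christoffel g x t a b + g x b t * Christoffel g x t a c) := by
  have h : ∀ i j k, pd i (fun y => g y j k) x = pd i (fun y => g y k j) x :=
    fun i j k => pd_congr hΩ hx (fun y hy => (hs y hy).apply k j) i
  rw [Finset.sum_add_distrib, sum_mul_Christoffel hdet, sum_mul_Christoffel hdet,
    h a c b, h c a b, h b a c]
  rw [h c b a]
  ring

lemma pd_vol_eq_Christoffel (hΩ : IsOpen Ω) (hx : x ∈ Ω)
    (hg : ∀ μ ν, ContDiffOn ℝ (⊤ : ℕ∞) (fun y => g y μ ν) Ω)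
    (hs : ∀ y ∈ Ω, (g y).IsSymm) (hdet : IsUnit (g x).det) (a : Fin 4) :
    pd a (vol g) x = vol g x * ∑ s, Christoffel g x s s a := by
  rw [pd_vol hΩ hx hg hdet, div_mul_eq_mul_div, mul_div_assoc]
  congr 1
  have hG : ∀ i j, ginv g x i j = ginv g x j i := fun i j => (ginv_isSymm (hs x hx)).apply j i
  have h : ∑ s, ∑ l, ginv g x s l * pd s (fun y => g y a l) x =
      ∑ s, ∑ l, ginv g x s l * pd l (fun y => g y s a) x := by
    rw [Finset.sum_comm]
    refine Finset.sum_congr rfl fun s _ => Finset.sum_congr rfl fun l _ => ?_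
    rw [hG, pd_congr hΩ hx (fun y hy => (hs y hy).apply s a) l]
  have h' : (ginv g x * pdMatrix a g x).trace =
      ∑ s, ∑ l, ginv g x s l * pd a (fun y => g y s l) x := by
    simp only [Matrix.trace, Matrix.diag, Matrix.mul_apply, pdMatrix_apply]
    refine Finset.sum_congr rfl fun s _ => Finset.sum_congr rfl fun l _ => ?_
    rw [pd_congr hΩ hx (fun y hy => (hs y hy).apply s l) a]
  simp only [h', Christoffel, mul_add, mul_sub, Finset.sum_add_distrib, Finset.sum_sub_distrib,
    ← Finset.mul_sum, h]
  ring

/-- The covariant derivative `∇_c ξ^a`. -/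
noncomputable def covDeriv (g : E4 → Matrix (Fin 4) (Fin 4) ℝ) (ξ : E4 → Fin 4 → ℝ)
    (x : E4) (c a : Fin 4) : ℝ :=
  pd c (fun y => ξ y a) x + ∑ t, Christoffel g x a c t * ξ x t

lemma pd_formOf (hΩ : IsOpen Ω) (hx : x ∈ Ω)
    (hg : ∀ μ ν, ContDiffOn ℝ (⊤ : ℕ∞) (fun y => g y μ ν) Ω)
    (hξ : ∀ μ, ContDiffOn ℝ (⊤ : ℕ∞) (fun y => ξ y μ) Ω)
    (hs : ∀ y ∈ Ω, (g y).IsSymm) (hdet : IsUnit (g x).det) (d c : Fin 4) :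
    pd d (fun y => formOf g ξ y c) x = ∑ s, g x c s * covDeriv g ξ x d s +
      ∑ t, ∑ s, ξ x s * g x s t * Christoffel g x t d c := by
  have hξd := fun s => (hξ s).differentiableAt_of_isOpen hΩ hx
  have hgd := fun a b => (hg a b).differentiableAt_of_isOpen hΩ hx
  simp only [formOf]
  rw [pd_sum fun t _ => (hgd _ _).fun_mul (hξd t),
    Finset.sum_congr rfl fun t _ => pd_mul (hgd c t) (hξd t) d]
  simp only [pd_metric hΩ hx hs hdet, covDeriv, mul_add, Finset.mul_sum, Finset.sum_add_distrib,
    add_assoc]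
  congr 1
  rw [add_comm]
  congr 1
  · rw [Finset.sum_comm]
    exact Finset.sum_congr rfl fun s _ => Finset.sum_congr rfl fun t _ => by ring
  · rw [Finset.sum_comm]
    exact Finset.sum_congr rfl fun s _ => Finset.sum_congr rfl fun t _ => by ring

lemma dform_eq (hΩ : IsOpen Ω) (hx : x ∈ Ω)
    (hg : ∀ μ ν, ContDiffOn ℝ (⊤ : ℕ∞) (fun y => g y μ ν) Ω)
    (hξ : ∀ μ, ContDiffOn ℝ (⊤ : ℕ∞) (fun y => ξ y μ) Ω)
    (hs : ∀ y ∈ Ω, (g y).IsSymm) (hdet : IsUnit (g x).det) (d c : Fin 4) :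
    dform g ξ x d c =
      ∑ s, g x c s * covDeriv g ξ x d s - ∑ s, g x d s * covDeriv g ξ x c s := by
  rw [dform, pd_formOf hΩ hx hg hξ hs hdet, pd_formOf hΩ hx hg hξ hs hdet]
  simp only [Christoffel_symm hΩ hx hs _ d c]
  ring

lemma lieD_metric (hΩ : IsOpen Ω) (hx : x ∈ Ω) (hs : ∀ y ∈ Ω, (g y).IsSymm)
    (hdet : IsUnit (g x).det) (d c : Fin 4) :
    lieD ξ g x d c =
      ∑ s, g x c s * covDeriv g ξ x d s + ∑ s, g x d s * covDeriv g ξ x c s := by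
  have h : ∑ s, ξ x s * pd s (fun y => g y d c) x =
      ∑ s, ∑ t, g x c s * (Christoffel g x s d t * ξ x t) +
        ∑ s, ∑ t, g x d s * (Christoffel g x s c t * ξ x t) := by
    simp only [pd_metric hΩ hx hs hdet, mul_add, Finset.mul_sum, Finset.sum_add_distrib]
    congr 1
    all_goals
      rw [Finset.sum_comm]
      refine Finset.sum_congr rfl fun s _ => Finset.sum_congr rfl fun t _ => ?_
      rw [Christoffel_symm hΩ hx hs s t]
      ring
  simp only [lieD, Finset.sum_add_distrib, h, covDeriv, mul_add, Finset.mul_sum,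
    fun s => (hs x hx).apply c s]
  ring

/-- For a Killing field `ξ`, `(dξ)_{dc} = -2 ∇_c ξ_d`. -/
lemma dform_of_killing (hΩ : IsOpen Ω) (hx : x ∈ Ω)
    (hg : ∀ μ ν, ContDiffOn ℝ (⊤ : ℕ∞) (fun y => g y μ ν) Ω)
    (hξ : ∀ μ, ContDiffOn ℝ (⊤ : ℕ∞) (fun y => ξ y μ) Ω)
    (hs : ∀ y ∈ Ω, (g y).IsSymm) (hdet : IsUnit (g x).det)
    (hL : ∀ μ ν, lieD ξ g x μ ν = 0) (d c : Fin 4) :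
    dform g ξ x d c = -2 * ∑ s, g x d s * covDeriv g ξ x c s := by
  have h := lieD_metric hΩ hx hs hdet (ξ := ξ) d c
  rw [hL] at h
  rw [dform_eq hΩ hx hg hξ hs hdet]
  linarith

lemma sum_raise_dform_mul (hΩ : IsOpen Ω) (hx : x ∈ Ω)
    (hg : ∀ μ ν, ContDiffOn ℝ (⊤ : ℕ∞) (fun y => g y μ ν) Ω)
    (hξ : ∀ μ, ContDiffOn ℝ (⊤ : ℕ∞) (fun y => ξ y μ) Ω)
    (hs : ∀ y ∈ Ω, (g y).IsSymm) (hdet : IsUnit (g x).det)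
    (hL : ∀ μ ν, lieD ξ g x μ ν = 0) (a c : Fin 4) :
    ∑ b, raise g (fun y => Matrix.of (dform g ξ y)) x a b * g x b c =
      -2 * vol g x * covDeriv g ξ x c a := by
  have hK : Matrix.of (dform g ξ x) = (-2 : ℝ) • (g x * (Matrix.of (covDeriv g ξ x))ᵀ) := by
    ext d c
    simp [dform_of_killing hΩ hx hg hξ hs hdet hL, Matrix.mul_apply]
  have h : raise g (fun y => Matrix.of (dform g ξ y)) x * g x =
      (-2 * vol g x) • (Matrix.of (covDeriv g ξ x))ᵀ := by
    rw [raise, hK, (ginv_isSymm (hs x hx)).eq, smul_mul_assoc, Matrix.mul_assoc _ _ (g x),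
      ginv_mul_self hdet, Matrix.mul_one, Matrix.mul_smul, ← Matrix.mul_assoc, ginv_mul_self hdet,
      Matrix.one_mul, smul_smul, mul_comm]
  have := congrFun (congrFun h a) c
  simpa [Matrix.mul_apply] using this

end LeviCivita

section Divergence

variable {Ω : Set E4} {g F : E4 → Matrix (Fin 4) (Fin 4) ℝ} {ξ : E4 → Fin 4 → ℝ} {x : E4}

lemma contDiffOn_covDeriv (hΩ : IsOpen Ω)
    (hg : ∀ μ ν, ContDiffOn ℝ (⊤ : ℕ∞) (fun y => g y μ ν) Ω)
    (hdet : ∀ y ∈ Ω, IsUnit (g y).det)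
    (hξ : ∀ μ, ContDiffOn ℝ (⊤ : ℕ∞) (fun y => ξ y μ) Ω) (c a : Fin 4) :
    ContDiffOn ℝ (⊤ : ℕ∞) (fun y => covDeriv g ξ y c a) Ω :=
  ((hξ a).pd hΩ c).add (ContDiffOn.sum fun t _ =>
    (contDiffOn_Christoffel hΩ hg hdet a c t).mul (hξ t))

lemma pd_covDeriv (hΩ : IsOpen Ω) (hx : x ∈ Ω)
    (hg : ∀ μ ν, ContDiffOn ℝ (⊤ : ℕ∞) (fun y => g y μ ν) Ω)
    (hdet : ∀ y ∈ Ω, IsUnit (g y).det)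
    (hξ : ∀ μ, ContDiffOn ℝ (⊤ : ℕ∞) (fun y => ξ y μ) Ω) (i c a : Fin 4) :
    pd i (fun y => covDeriv g ξ y c a) x = pd i (pd c fun y => ξ y a) x +
      (∑ t, Christoffel g x a c t * pd i (fun y => ξ y t) x +
        ∑ t, pd i (fun y => Christoffel g y a c t) x * ξ x t) := by
  have hξd := fun s => (hξ s).differentiableAt_of_isOpen hΩ hx
  have hΓ := fun s μ ν =>
    (contDiffOn_Christoffel hΩ hg hdet s μ ν).differentiableAt_of_isOpen hΩ hx
  have h1 := (((hξ a).pd hΩ c).differentiableAt_of_isOpen hΩ hx)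
  simp only [covDeriv]
  rw [pd_add h1 (DifferentiableAt.fun_sum fun t _ => (hΓ a c t).fun_mul (hξd t)),
    pd_sum fun t _ => (hΓ a c t).fun_mul (hξd t),
    Finset.sum_congr rfl fun t _ => pd_mul (hΓ a c t) (hξd t) i, Finset.sum_add_distrib]
  simp only [mul_comm (ξ x _)]

lemma vol_pos (hdet : IsUnit (g x).det) : 0 < vol g x :=
  Real.sqrt_pos.2 (abs_pos.2 hdet.ne_zero)

lemma dform_transpose (x : E4) :
    (Matrix.of (dform g ξ x))ᵀ = -Matrix.of (dform g ξ x) := by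
  ext a b
  simp [dform]

/-- A Killing field is divergence-free. -/
lemma sum_covDeriv_self (hΩ : IsOpen Ω) (hx : x ∈ Ω)
    (hg : ∀ μ ν, ContDiffOn ℝ (⊤ : ℕ∞) (fun y => g y μ ν) Ω)
    (hξ : ∀ μ, ContDiffOn ℝ (⊤ : ℕ∞) (fun y => ξ y μ) Ω)
    (hs : ∀ y ∈ Ω, (g y).IsSymm) (hdet : IsUnit (g x).det)
    (hL : ∀ μ ν, lieD ξ g x μ ν = 0) : ∑ a, covDeriv g ξ x a a = 0 := by
  set P := raise g (fun y => Matrix.of (dform g ξ y)) x with hP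
  have hPa : ∀ a b, P a b = -P b a := raise_anti (dform_transpose x)
  have h1 : ∑ a, ∑ b, P a b * g x b a = 0 := by
    have h2 : ∑ a, ∑ b, P a b * g x b a = -∑ a, ∑ b, P a b * g x b a := by
      conv_lhs => rw [Finset.sum_comm]
      simp only [← Finset.sum_neg_distrib]
      refine Finset.sum_congr rfl fun a _ => Finset.sum_congr rfl fun b _ => ?_
      rw [hPa b a, (hs x hx).apply b a]
      ring
    linarith
  simp only [hP, sum_raise_dform_mul hΩ hx hg hξ hs hdet hL, ← Finset.mul_sum] at h1
  have := vol_pos hdet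
  rcases mul_eq_zero.1 h1 with h | h
  · linarith
  · exact h

/-- The contracted Ricci identity for a Killing field. -/
lemma sum_pd_covDeriv (hΩ : IsOpen Ω) (hx : x ∈ Ω)
    (hg : ∀ μ ν, ContDiffOn ℝ (⊤ : ℕ∞) (fun y => g y μ ν) Ω)
    (hξ : ∀ μ, ContDiffOn ℝ (⊤ : ℕ∞) (fun y => ξ y μ) Ω)
    (hs : ∀ y ∈ Ω, (g y).IsSymm) (hdet : ∀ y ∈ Ω, IsUnit (g y).det)
    (hL : ∀ y ∈ Ω, ∀ μ ν, lieD ξ g y μ ν = 0) (c : Fin 4) :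
    ∑ a, (pd a (fun y => covDeriv g ξ y c a) x +
      (∑ s, Christoffel g x s s a) * covDeriv g ξ x c a -
      ∑ t, Christoffel g x t a c * covDeriv g ξ x t a) = ∑ ν, RicciT g x c ν * ξ x ν := by
  have hD := fun a => (contDiffOn_covDeriv hΩ hg hdet hξ a a).differentiableAt_of_isOpen hΩ hx
  have h0 := pd_congr hΩ hx
    (fun y hy => sum_covDeriv_self hΩ hy hg hξ hs (hdet y hy) (hL y hy)) c
  rw [pd_const, pd_sum fun a _ => hD a] at h0
  simp only [pd_covDeriv hΩ hx hg hdet hξ] at h0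
  rw [← sub_zero (∑ a, _), ← h0]
  simp only [pd_covDeriv hΩ hx hg hdet hξ, fun a => pd_comm (hξ a) hΩ hx a c]
  have e1 : ∑ a, ∑ t, Christoffel g x a c t * pd a (fun y => ξ y t) x =
      ∑ a, ∑ t, Christoffel g x t a c * pd t (fun y => ξ y a) x := by
    rw [Finset.sum_comm]
    refine Finset.sum_congr rfl fun a _ => Finset.sum_congr rfl fun t _ => ?_
    rw [Christoffel_symm hΩ hx hs]
  have e2 : ∑ a, ∑ t, Christoffel g x a a t * pd c (fun y => ξ y t) x =
      ∑ a, (∑ s, Christoffel g x s s a) * pd c (fun y => ξ y a) x := by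
    rw [Finset.sum_comm]
    simp only [Finset.sum_mul]
  have e3 : ∑ a, (∑ s, Christoffel g x s s a) * ∑ t, Christoffel g x a c t * ξ x t =
      ∑ ν, (∑ s, ∑ l, Christoffel g x s s l * Christoffel g x l c ν) * ξ x ν := by
    simp only [Finset.sum_mul, Finset.mul_sum]
    rw [Finset.sum_comm]
    refine Finset.sum_congr rfl fun ν _ => ?_
    rw [Finset.sum_comm]
    exact Finset.sum_congr rfl fun _ _ => Finset.sum_congr rfl fun _ _ => by ring
  have e4 : ∑ a, ∑ t, Christoffel g x t a c * ∑ s, Christoffel g x a t s * ξ x s =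
      ∑ ν, (∑ s, ∑ l, Christoffel g x s c l * Christoffel g x l s ν) * ξ x ν := by
    simp only [Finset.sum_mul, Finset.mul_sum]
    rw [Finset.sum_comm_cycle]
    refine Finset.sum_congr rfl fun ν _ => ?_
    rw [Finset.sum_comm]
    refine Finset.sum_congr rfl fun s _ => Finset.sum_congr rfl fun l _ => ?_
    rw [Christoffel_symm hΩ hx hs s l c]
    ring
  have e5 : ∀ f : Fin 4 → Fin 4 → ℝ, ∑ a, ∑ t, f a t * ξ x t = ∑ t, (∑ a, f a t) * ξ x t := by
    intro f
    rw [Finset.sum_comm]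
    simp only [Finset.sum_mul]
  simp only [covDeriv, mul_add, Finset.sum_add_distrib, Finset.sum_sub_distrib, RicciT, add_mul,
    sub_mul, e5, e1, e2, e3, e4]
  ring

/-- For a Killing field `ξ`, the divergence of `dξ` is given by the Ricci tensor. -/
lemma sum_pd_raise_dform_mul (hΩ : IsOpen Ω) (hx : x ∈ Ω)
    (hg : ∀ μ ν, ContDiffOn ℝ (⊤ : ℕ∞) (fun y => g y μ ν) Ω)
    (hξ : ∀ μ, ContDiffOn ℝ (⊤ : ℕ∞) (fun y => ξ y μ) Ω)
    (hs : ∀ y ∈ Ω, (g y).IsSymm) (hdet : ∀ y ∈ Ω, IsUnit (g y).det)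
    (hL : ∀ y ∈ Ω, ∀ μ ν, lieD ξ g y μ ν = 0) (c : Fin 4) :
    ∑ b, (∑ a, pdMatrix a (raise g fun y => Matrix.of (dform g ξ y)) x a b) * g x b c =
      -2 * vol g x * ∑ ν, RicciT g x c ν * ξ x ν := by
  set P := raise g fun y => Matrix.of (dform g ξ y) with hP
  have hPsm : ∀ a b, DifferentiableAt ℝ (fun y => P y a b) x := fun a b =>
    (contDiffOn_raise hg hdet (contDiffOn_dform hΩ hg hξ) a b).differentiableAt_of_isOpen hΩ hx
  have hgd := fun a b => (hg a b).differentiableAt_of_isOpen hΩ hx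
  have hvol := (contDiffOn_vol hg hdet).differentiableAt_of_isOpen hΩ hx
  have hD := fun c a => (contDiffOn_covDeriv hΩ hg hdet hξ c a).differentiableAt_of_isOpen hΩ hx
  have hPg : ∀ y ∈ Ω, ∀ a c, ∑ b, P y a b * g y b c = -2 * vol g y * covDeriv g ξ y c a :=
    fun y hy => sum_raise_dform_mul hΩ hy hg hξ hs (hdet y hy) (hL y hy)
  have hPa : ∀ a b, P x a b = -P x b a := raise_anti (dform_transpose x)
  have h1 : ∀ a, ∑ b, (P x a b * pd a (fun y => g y b c) x +
      g x b c * pd a (fun y => P y a b) x) =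
      -2 * (vol g x * pd a (fun y => covDeriv g ξ y c a) x +
        covDeriv g ξ x c a * (vol g x * ∑ s, Christoffel g x s s a)) := by
    intro a
    have h := pd_congr hΩ hx (fun y hy => hPg y hy a c) a
    rw [pd_sum fun b _ => (hPsm a b).fun_mul (hgd b c),
      Finset.sum_congr rfl fun b _ => pd_mul (hPsm a b) (hgd b c) a] at h
    rw [h]
    simp only [mul_assoc]
    rw [pd_const_mul (hvol.fun_mul (hD c a)), pd_mul hvol (hD c a),
      pd_vol_eq_Christoffel hΩ hx hg hs (hdet x hx)]
  have h2 : ∑ a, ∑ b, P x a b * pd a (fun y => g y b c) x =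
      ∑ a, ∑ t, -2 * vol g x * covDeriv g ξ x t a * Christoffel g x t a c := by
    have h3 : ∑ a, ∑ b, P x a b * ∑ t, g x c t * Christoffel g x t a b = 0 := by
      have h4 : ∑ a, ∑ b, P x a b * ∑ t, g x c t * Christoffel g x t a b =
          -∑ a, ∑ b, P x a b * ∑ t, g x c t * Christoffel g x t a b := by
        conv_lhs => rw [Finset.sum_comm]
        simp only [← Finset.sum_neg_distrib]
        refine Finset.sum_congr rfl fun a _ => Finset.sum_congr rfl fun b _ => ?_
        simp only [hPa b a, fun t => Christoffel_symm hΩ hx hs t b a, neg_mul]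
      linarith
    simp only [pd_metric hΩ hx hs (hdet x hx), Finset.sum_add_distrib, mul_add, h3, zero_add,
      ← hPg x hx]
    refine Finset.sum_congr rfl fun a _ => ?_
    simp only [Finset.mul_sum, Finset.sum_mul]
    rw [Finset.sum_comm]
    exact Finset.sum_congr rfl fun _ _ => Finset.sum_congr rfl fun _ _ => by ring
  have h5 : ∑ b, (∑ a, pdMatrix a P x a b) * g x b c =
      ∑ a, ∑ b, g x b c * pd a (fun y => P y a b) x := by
    simp only [Finset.sum_mul, pdMatrix_apply]
    rw [Finset.sum_comm]
    exact Finset.sum_congr rfl fun _ _ => Finset.sum_congr rfl fun _ _ => mul_comm _ _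
  have h6 := Finset.sum_congr rfl fun a (_ : a ∈ Finset.univ) => h1 a
  simp only [Finset.sum_add_distrib] at h6
  rw [h2, ← h5] at h6
  rw [eq_sub_of_add_eq' h6, ← sum_pd_covDeriv hΩ hx hg hξ hs hdet hL, Finset.mul_sum,
    ← Finset.sum_sub_distrib]
  refine Finset.sum_congr rfl fun a _ => ?_
  rw [mul_sub, Finset.mul_sum _ _ (-2 * vol g x)]
  congr 1
  · ring
  · exact Finset.sum_congr rfl fun _ _ => by ring

/-- The contraction of the energy-momentum tensor with `ξ`. -/
lemma sum_TF_mul (x : E4) (c : Fin 4) :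
    ∑ ν, TF g F x c ν * ξ x ν = ∑ a, ∑ b, ginv g x a b * F x c a * alphaF F ξ x b -
      (1 / 2) * normF2 g F x * formOf g ξ x c := by
  simp only [TF, sub_mul, Finset.sum_sub_distrib, formOf, alphaF, Finset.mul_sum, Finset.sum_mul]
  congr 1
  · rw [Finset.sum_comm]
    refine Finset.sum_congr rfl fun a _ => ?_
    rw [Finset.sum_comm]
    exact Finset.sum_congr rfl fun b _ => Finset.sum_congr rfl fun ν _ => by ring
  · exact Finset.sum_congr rfl fun ν _ => by ring

/-- The divergence of `dξ` for a Killing field of a solution of the Einstein-Maxwell equations. -/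
lemma sum_pd_raise_dform (hΩ : IsOpen Ω) (hx : x ∈ Ω)
    (hg : ∀ μ ν, ContDiffOn ℝ (⊤ : ℕ∞) (fun y => g y μ ν) Ω)
    (hξ : ∀ μ, ContDiffOn ℝ (⊤ : ℕ∞) (fun y => ξ y μ) Ω)
    (hs : ∀ y ∈ Ω, (g y).IsSymm) (hdet : ∀ y ∈ Ω, IsUnit (g y).det)
    (hL : ∀ y ∈ Ω, ∀ μ ν, lieD ξ g y μ ν = 0)
    (hE : ∀ μ ν, RicciT g x μ ν = 2 * TF g F x μ ν) (b : Fin 4) :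
    ∑ a, pdMatrix a (raise g fun y => Matrix.of (dform g ξ y)) x a b =
      -4 * (∑ d, raise g F x b d * alphaF F ξ x d) + 2 * vol g x * normF2 g F x * ξ x b := by
  set J : Fin 4 → ℝ := fun b =>
    ∑ a, pdMatrix a (raise g fun y => Matrix.of (dform g ξ y)) x a b
  have hG : ∀ i j, ginv g x i j = ginv g x j i := fun i j => (ginv_isSymm (hs x hx)).apply j i
  have h : J ᵥ* g x = fun c => -4 * vol g x *
      (∑ i, ∑ j, ginv g x i j * F x c i * alphaF F ξ x j) +
        2 * vol g x * normF2 g F x * formOf g ξ x c := by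
    funext c
    refine (sum_pd_raise_dform_mul hΩ hx hg hξ hs hdet hL c).trans ?_
    simp only [hE, mul_assoc, ← Finset.mul_sum]
    rw [sum_TF_mul]
    simp only [mul_assoc]
    ring
  have h' := congrFun (congrArg (· ᵥ* ginv g x) h) b
  simp only [Matrix.vecMul_vecMul, mul_ginv_self (hdet x hx), Matrix.vecMul_one] at h'
  refine h'.trans ?_
  have hQ : ∑ d, raise g F x b d * alphaF F ξ x d = vol g x *
      ∑ c, (∑ i, ∑ j, ginv g x i j * F x c i * alphaF F ξ x j) * ginv g x c b := by
    simp only [raise, Matrix.smul_apply, Matrix.mul_apply, Matrix.transpose_apply, smul_eq_mul,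
      mul_assoc, ← Finset.mul_sum]
    congr 1
    simp only [Finset.sum_mul, Finset.mul_sum]
    rw [Finset.sum_comm_cycle, Finset.sum_congr rfl fun _ _ => Finset.sum_comm, Finset.sum_comm]
    refine Finset.sum_congr rfl fun c _ => Finset.sum_congr rfl fun i _ =>
      Finset.sum_congr rfl fun j _ => ?_
    rw [hG b c, hG j i]
    ring
  rw [hQ, ← sum_ginv_mul_formOf (ξ := ξ) (hdet x hx) b]
  simp only [Matrix.vecMul, dotProduct, add_mul, Finset.sum_add_distrib, mul_assoc,
    ← Finset.mul_sum, hG _ b, mul_comm (formOf g ξ x _)]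

end Divergence

section Potentials

variable {Ω : Set E4} {g F : E4 → Matrix (Fin 4) (Fin 4) ℝ} {ξ : E4 → Fin 4 → ℝ} {x : E4}

lemma alphaF_closed (hΩ : IsOpen Ω) (hx : x ∈ Ω)
    (hF : ∀ μ ν, ContDiffOn ℝ (⊤ : ℕ∞) (fun y => F y μ ν) Ω)
    (hξ : ∀ μ, ContDiffOn ℝ (⊤ : ℕ∞) (fun y => ξ y μ) Ω)
    (hFanti : ∀ y ∈ Ω, (F y)ᵀ = -F y) (hLF : ∀ μ ν, lieD ξ F x μ ν = 0)
    (hdF : ∀ a b c, pd a (fun y => F y b c) x + pd b (fun y => F y c a) x +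
      pd c (fun y => F y a b) x = 0) (μ ν : Fin 4) :
    pd μ (fun y => alphaF F ξ y ν) x - pd ν (fun y => alphaF F ξ y μ) x = 0 := by
  refine (pd_contract_sub hΩ hx hξ hF (fun y hy μ ν => ?_) μ ν (hLF μ ν)).trans ?_
  · exact congrFun (congrFun (hFanti y hy) ν) μ
  · simp [hdF]

lemma betaF_closed (hΩ : IsOpen Ω) (hx : x ∈ Ω)
    (hg : ∀ μ ν, ContDiffOn ℝ (⊤ : ℕ∞) (fun y => g y μ ν) Ω)
    (hF : ∀ μ ν, ContDiffOn ℝ (⊤ : ℕ∞) (fun y => F y μ ν) Ω)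
    (hξ : ∀ μ, ContDiffOn ℝ (⊤ : ℕ∞) (fun y => ξ y μ) Ω)
    (hs : (g x).IsSymm) (hdet : ∀ y ∈ Ω, IsUnit (g y).det)
    (hLg : ∀ μ ν, lieD ξ g x μ ν = 0) (hLF : ∀ μ ν, lieD ξ F x μ ν = 0)
    (hd : ∀ a b c, pd a (fun y => star2 g F y b c) x + pd b (fun y => star2 g F y c a) x +
      pd c (fun y => star2 g F y a b) x = 0) (μ ν : Fin 4) :
    pd μ (fun y => betaF g F ξ y ν) x - pd ν (fun y => betaF g F ξ y μ) x = 0 := by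
  refine (pd_contract_sub (S := fun y => Matrix.of (star2 g F y)) hΩ hx hξ
    (contDiffOn_star2 hg hdet hF) (fun y _ μ ν => star2_anti y μ ν) μ ν
    (lieD_star2 hΩ hx hg hdet hs hF hLg hLF μ ν)).trans ?_
  simp [hd]

/-- The twist equation `dω = 4 α ∧ β`. -/
lemma pd_twistF_sub (hΩ : IsOpen Ω) (hx : x ∈ Ω)
    (hg : ∀ μ ν, ContDiffOn ℝ (⊤ : ℕ∞) (fun y => g y μ ν) Ω)
    (hξ : ∀ μ, ContDiffOn ℝ (⊤ : ℕ∞) (fun y => ξ y μ) Ω)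
    (hs : ∀ y ∈ Ω, (g y).IsSymm) (hdet : ∀ y ∈ Ω, IsUnit (g y).det)
    (hFanti : (F x)ᵀ = -F x)
    (hL : ∀ y ∈ Ω, ∀ μ ν, lieD ξ g y μ ν = 0)
    (hE : ∀ μ ν, RicciT g x μ ν = 2 * TF g F x μ ν) (μ ν : Fin 4) :
    pd μ (fun y => twistF g ξ y ν) x - pd ν (fun y => twistF g ξ y μ) x =
      4 * (alphaF F ξ x μ * betaF g F ξ x ν - alphaF F ξ x ν * betaF g F ξ x μ) := by
  set K : E4 → Matrix (Fin 4) (Fin 4) ℝ := fun y => Matrix.of (dform g ξ y) with hK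
  have hKsm : ∀ μ ν, ContDiffOn ℝ (⊤ : ℕ∞) (fun y => K y μ ν) Ω := contDiffOn_dform hΩ hg hξ
  have hD : ∀ c a b, pdMatrix c (raise g K) x a b = -pdMatrix c (raise g K) x b a := by
    intro c a b
    rw [pdMatrix_apply, pdMatrix_apply,
      pd_congr hΩ hx (fun y _ => raise_anti (dform_transpose y) a b), pd_neg]
  have hQ : ∀ a b, raise g F x a b = -raise g F x b a := raise_anti hFanti
  have hαξ : ∑ c, alphaF F ξ x c * ξ x c = 0 := by
    have h : ∑ c, alphaF F ξ x c * ξ x c = -∑ c, alphaF F ξ x c * ξ x c := by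
      simp only [alphaF, Finset.sum_mul, ← Finset.sum_neg_distrib]
      rw [Finset.sum_comm]
      refine Finset.sum_congr rfl fun a _ => Finset.sum_congr rfl fun b _ => ?_
      rw [show F x a b = -F x b a from congrFun (congrFun hFanti b) a]
      ring
    linarith
  rw [pd_congr hΩ hx fun y hy => twistF_eq (hdet y hy) ν,
    pd_congr hΩ hx fun y hy => twistF_eq (hdet y hy) μ]
  refine (pd_contract_sub (S := fun y => Matrix.of (star2 g K y)) hΩ hx hξ
    (contDiffOn_star2 hg hdet hKsm) (fun y _ μ ν => star2_anti y μ ν) μ ν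
    (lieD_star2 hΩ hx hg hdet (hs x hx) hKsm (hL x hx)
      (lieD_dform hΩ hx hg hξ hL) μ ν)).trans ?_
  have h := wedge_dual hQ hαξ (2 * vol g x * normF2 g F x) μ ν
  simp only [← star2_eq, ← sum_pd_raise_dform hΩ hx hg hξ hs hdet hL hE] at h
  simp only [betaF]
  rw [← h, ← Finset.sum_neg_distrib]
  refine Finset.sum_congr rfl fun c _ => ?_
  simp only [Matrix.of_apply, pd_star2 hΩ hx hg hdet hKsm, cyclic_dual hD]
  ring

end Potentials

theorem ernst_potentials_exist
    (Ω : Set E4) (hΩ : IsOpen Ω) (hsc : SimplyConnectedSpace Ω)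
    (g F : E4 → Matrix (Fin 4) (Fin 4) ℝ) (ξ : E4 → Fin 4 → ℝ)
    (hgsm : ∀ μ ν, ContDiffOn ℝ (⊤ : ℕ∞) (fun y => g y μ ν) Ω)
    (hFsm : ∀ μ ν, ContDiffOn ℝ (⊤ : ℕ∞) (fun y => F y μ ν) Ω)
    (hξsm : ∀ μ, ContDiffOn ℝ (⊤ : ℕ∞) (fun y => ξ y μ) Ω)
    (hgsymm : ∀ x ∈ Ω, (g x).IsSymm)
    (hgnd : ∀ x ∈ Ω, IsUnit (g x).det)
    (hFanti : ∀ x ∈ Ω, (F x)ᵀ = -(F x))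
    -- `ξ` is a Killing field: `L_ξ g = 0`
    (hKilling : ∀ x ∈ Ω, ∀ μ ν, lieD ξ g x μ ν = 0)
    -- `ξ` leaves the field invariant: `L_ξ F = 0`
    (hLieF : ∀ x ∈ Ω, ∀ μ ν, lieD ξ F x μ ν = 0)
    -- Maxwell equations `dF = 0`, `d ∗F = 0`
    (hdF : ∀ x ∈ Ω, ∀ a b c,
      pd a (fun y => F y b c) x + pd b (fun y => F y c a) x + pd c (fun y => F y a b) x = 0)
    (hdstarF : ∀ x ∈ Ω, ∀ a b c,
      pd a (fun y => star2 g F y b c) x + pd b (fun y => star2 g F y c a) x +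
        pd c (fun y => star2 g F y a b) x = 0)
    -- Einstein equations `Ric = 2 T_F`
    (hEinstein : ∀ x ∈ Ω, ∀ μ ν, RicciT g x μ ν = 2 * TF g F x μ ν) :
    -- `dα = 0`
    (∀ x ∈ Ω, ∀ μ ν,
      pd μ (fun y => alphaF F ξ y ν) x - pd ν (fun y => alphaF F ξ y μ) x = 0) ∧
    -- `dβ = 0`
    (∀ x ∈ Ω, ∀ μ ν,
      pd μ (fun y => betaF g F ξ y ν) x - pd ν (fun y => betaF g F ξ y μ) x = 0) ∧
    -- `dω = 4 α ∧ β`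
    (∀ x ∈ Ω, ∀ μ ν,
      pd μ (fun y => twistF g ξ y ν) x - pd ν (fun y => twistF g ξ y μ) x =
        4 * (alphaF F ξ x μ * betaF g F ξ x ν - alphaF F ξ x ν * betaF g F ξ x μ)) ∧
    -- potentials `χ, ψ` and `v`
    (∃ χ ψ : E4 → ℝ, ContDiffOn ℝ (⊤ : ℕ∞) χ Ω ∧ ContDiffOn ℝ (⊤ : ℕ∞) ψ Ω ∧
      (∀ x ∈ Ω, ∀ μ, pd μ χ x = alphaF F ξ x μ) ∧
      (∀ x ∈ Ω, ∀ μ, pd μ ψ x = betaF g F ξ x μ) ∧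
      -- `ω − 2(χ dψ − ψ dχ)` is closed …
      (∀ x ∈ Ω, ∀ μ ν,
        pd μ (fun y => twistF g ξ y ν - 2 * (χ y * pd ν ψ y - ψ y * pd ν χ y)) x -
        pd ν (fun y => twistF g ξ y μ - 2 * (χ y * pd μ ψ y - ψ y * pd μ χ y)) x = 0) ∧
      -- … hence exact: `2 dv = ω − 2(χ dψ − ψ dχ)`
      (∃ v : E4 → ℝ, ContDiffOn ℝ (⊤ : ℕ∞) v Ω ∧ ∀ x ∈ Ω, ∀ μ,
        2 * pd μ v x = twistF g ξ x μ - 2 * (χ x * pd μ ψ x - ψ x * pd μ χ x))) := by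
  have hclα := fun x hx => alphaF_closed hΩ hx hFsm hξsm hFanti (hLieF x hx) (hdF x hx)
  have hclβ := fun x hx => betaF_closed hΩ hx hgsm hFsm hξsm (hgsymm x hx) hgnd (hKilling x hx)
    (hLieF x hx) (hdstarF x hx)
  have hω := fun x hx => pd_twistF_sub hΩ hx hgsm hξsm hgsymm hgnd (hFanti x hx) hKilling
    (hEinstein x hx)
  refine ⟨hclα, hclβ, hω, ?_⟩
  have hα : ∀ μ, ContDiffOn ℝ (⊤ : ℕ∞) (fun y => alphaF F ξ y μ) Ω := fun μ =>
    ContDiffOn.sum fun s _ => (hξsm s).mul (hFsm s μ)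
  have hβ : ∀ μ, ContDiffOn ℝ (⊤ : ℕ∞) (fun y => betaF g F ξ y μ) Ω := fun μ =>
    ContDiffOn.sum fun s _ => (hξsm s).mul (contDiffOn_star2 hgsm hgnd hFsm s μ)
  have htw : ∀ μ, ContDiffOn ℝ (⊤ : ℕ∞) (fun y => twistF g ξ y μ) Ω := fun μ =>
    (ContDiffOn.sum fun s _ => (hξsm s).mul (contDiffOn_star2 hgsm hgnd
      (contDiffOn_dform hΩ hgsm hξsm) s μ)).congr fun y hy => twistF_eq (hgnd y hy) μ
  obtain ⟨χ, hχsm, hχ⟩ := exists_potential hΩ hα hclα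
  obtain ⟨ψ, hψsm, hψ⟩ := exists_potential hΩ hβ hclβ
  have hclosed : ∀ x ∈ Ω, ∀ μ ν,
      pd μ (fun y => twistF g ξ y ν - 2 * (χ y * pd ν ψ y - ψ y * pd ν χ y)) x -
        pd ν (fun y => twistF g ξ y μ - 2 * (χ y * pd μ ψ y - ψ y * pd μ χ y)) x = 0 := by
    intro x hx μ ν
    have hχd := hχsm.differentiableAt_of_isOpen hΩ hx
    have hψd := hψsm.differentiableAt_of_isOpen hΩ hx
    have hχd' := fun i => (hχsm.pd hΩ i).differentiableAt_of_isOpen hΩ hx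
    have hψd' := fun i => (hψsm.pd hΩ i).differentiableAt_of_isOpen hΩ hx
    have hexp : ∀ i j,
        pd i (fun y => twistF g ξ y j - 2 * (χ y * pd j ψ y - ψ y * pd j χ y)) x =
          pd i (fun y => twistF g ξ y j) x - 2 * (χ x * pd i (pd j ψ) x +
            pd j ψ x * pd i χ x - (ψ x * pd i (pd j χ) x + pd j χ x * pd i ψ x)) := by
      intro i j
      have h1 := hχd.fun_mul (hψd' j)
      have h2 := hψd.fun_mul (hχd' j)
      rw [pd_sub ((htw j).differentiableAt_of_isOpen hΩ hx) ((h1.fun_sub h2).const_mul 2),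
        pd_const_mul (h1.fun_sub h2), pd_sub h1 h2, pd_mul hχd (hψd' j), pd_mul hψd (hχd' j)]
    have h := hω x hx μ ν
    simp only [← hχ x hx, ← hψ x hx] at h
    rw [hexp, hexp, pd_comm hχsm hΩ hx ν μ, pd_comm hψsm hΩ hx ν μ]
    linear_combination h
  obtain ⟨f, hfsm, hf⟩ := exists_potential hΩ
    (A := fun y ν => twistF g ξ y ν - 2 * (χ y * pd ν ψ y - ψ y * pd ν χ y))
    (fun ν => (htw ν).sub (contDiffOn_const.mul
      ((hχsm.mul (hψsm.pd hΩ ν)).sub (hψsm.mul (hχsm.pd hΩ ν))))) hclosed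
  refine ⟨χ, ψ, hχsm, hψsm, hχ, hψ, hclosed, fun y => (1 / 2) * f y,
    contDiffOn_const.mul hfsm, fun x hx μ => ?_⟩
  rw [pd_const_mul (hfsm.differentiableAt_of_isOpen hΩ hx), hf x hx]
  ring
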